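/- arXiv:0801.3974 — 5 statements merged into one kernel-verified Lean document; each statement's English description precedes it below -/
import Mathlib

section
/- Existence and uniqueness of Harder–Narasimhan filtrations: for every stability function Z and every nonzero module M there exists a unique filtration 0 = M₀ ⊂ M₁ ⊂ ⋯ ⊂ Mₙ = M by submodules such that each successive factor Fᵢ = Mᵢ/Mᵢ₋₁ is Z-semistable and the phases strictly decrease: φ(F₁) > φ(F₂) > ⋯ > φ(Fₙ). -/
open Complex

/-- A stability function on the category of finite-dimensional left `R`-modules:
an assignment of a complex number to every module, invariant under isomorphism,
additive on short exact sequences, and taking nonzero modules into the upper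
half-plane. -/
structure StabilityFunction (R : Type) [Ring R] [Algebra ℂ R] : Type 1 where
  Z : ∀ (V : Type) [AddCommGroup V] [Module ℂ V] [Module R V]
      [IsScalarTower ℂ R V] [FiniteDimensional ℂ V], ℂ
  iso_invariant : ∀ (V W : Type) [AddCommGroup V] [Module ℂ V] [Module R V]
      [IsScalarTower ℂ R V] [FiniteDimensional ℂ V]
      [AddCommGroup W] [Module ℂ W] [Module R W]
      [IsScalarTower ℂ R W] [FiniteDimensional ℂ W],
      (V ≃ₗ[R] W) → Z V = Z W
  additive : ∀ (A M B : Type)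
      [AddCommGroup A] [Module ℂ A] [Module R A] [IsScalarTower ℂ R A] [FiniteDimensional ℂ A]
      [AddCommGroup M] [Module ℂ M] [Module R M] [IsScalarTower ℂ R M] [FiniteDimensional ℂ M]
      [AddCommGroup B] [Module ℂ B] [Module R B] [IsScalarTower ℂ R B] [FiniteDimensional ℂ B]
      (f : A →ₗ[R] M) (g : M →ₗ[R] B),
      Function.Injective f → Function.Surjective g →
      LinearMap.range f = LinearMap.ker g →
      Z M = Z A + Z B
  upperHalf : ∀ (V : Type) [AddCommGroup V] [Module ℂ V] [Module R V]
      [IsScalarTower ℂ R V] [FiniteDimensional ℂ V],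
      Nontrivial V → 0 < (Z V).im

variable {R : Type} [Ring R] [Algebra ℂ R]

/-- Any `R`-submodule of a finite-dimensional module is finite-dimensional over `ℂ`. -/
instance Submodule.instFDC {M : Type} [AddCommGroup M] [Module ℂ M] [Module R M]
    [IsScalarTower ℂ R M] [FiniteDimensional ℂ M] (A : Submodule R M) :
    FiniteDimensional ℂ A :=
  inferInstanceAs (FiniteDimensional ℂ (A.restrictScalars ℂ))

/-- Any quotient by an `R`-submodule of a finite-dimensional module is
finite-dimensional over `ℂ`. -/
instance Submodule.instQuotFDC {M : Type} [AddCommGroup M] [Module ℂ M] [Module R M]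
    [IsScalarTower ℂ R M] [FiniteDimensional ℂ M] (K : Submodule R M) :
    FiniteDimensional ℂ (M ⧸ K) :=
  Module.Finite.of_surjective (K.mkQ.restrictScalars ℂ) (Submodule.mkQ_surjective K)

/-- The phase `φ(M) = (1/π)·arg Z(M)` of a module. -/
noncomputable def StabilityFunction.phase (σ : StabilityFunction R) (V : Type)
    [AddCommGroup V] [Module ℂ V] [Module R V] [IsScalarTower ℂ R V]
    [FiniteDimensional ℂ V] : ℝ :=
  (σ.Z V).arg / Real.pi

/-- A module is `Z`-semistable if it is nonzero and every nonzero submodule has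
phase at most the phase of the module. -/
def StabilityFunction.IsSemistable (σ : StabilityFunction R) (M : Type)
    [AddCommGroup M] [Module ℂ M] [Module R M] [IsScalarTower ℂ R M]
    [FiniteDimensional ℂ M] : Prop :=
  Nontrivial M ∧ ∀ A : Submodule R M, A ≠ ⊥ → σ.phase A ≤ σ.phase M

/-- The subquotient `q/p` associated to a pair of submodules. -/
abbrev StabilityFunction.subfactor {M : Type} [AddCommGroup M] [Module ℂ M] [Module R M]
    [IsScalarTower ℂ R M] [FiniteDimensional ℂ M] (p q : Submodule R M) : Type :=
  ↥q ⧸ (p.comap q.subtype)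

/-- `F` is a Harder–Narasimhan filtration of `M`: a strictly increasing chain of
submodules `0 = M₀ ⊂ M₁ ⊂ ⋯ ⊂ Mₙ = M` whose successive factors `Fᵢ = Mᵢ/Mᵢ₋₁` are
`Z`-semistable of strictly decreasing phases. -/
def StabilityFunction.IsHNFiltration (σ : StabilityFunction R) {M : Type}
    [AddCommGroup M] [Module ℂ M] [Module R M] [IsScalarTower ℂ R M]
    [FiniteDimensional ℂ M] (n : ℕ) (F : Fin (n + 1) → Submodule R M) : Prop :=
  F 0 = ⊥ ∧ F (Fin.last n) = ⊤ ∧ StrictMono F ∧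
  (∀ i : Fin n, σ.IsSemistable (StabilityFunction.subfactor (F i.castSucc) (F i.succ))) ∧
  (∀ i j : Fin n, i < j →
    σ.phase (StabilityFunction.subfactor (F j.castSucc) (F j.succ)) <
      σ.phase (StabilityFunction.subfactor (F i.castSucc) (F i.succ)))

namespace HarderNarasimhan

section Lattice

variable {L : Type*} [Lattice L] {d r : L → ℝ}

/-- The slope of the interval `[x, y]` with respect to a degree `d` and a rank `r`. -/
noncomputable def slope (d r : L → ℝ) (x y : L) : ℝ := (d y - d x) / (r y - r x)

/-- The interval `[x, y]` is nontrivial and no initial subinterval has larger slope. -/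
def IsSemistable (d r : L → ℝ) (x y : L) : Prop :=
  x < y ∧ ∀ z, x < z → z ≤ y → slope d r x z ≤ slope d r x y

/-- `y` is the largest among the elements above `x` of maximal slope. -/
def IsMaxDestabilizing (d r : L → ℝ) (x y : L) : Prop :=
  IsSemistable d r x y ∧ ∀ z, x < z → ¬ z ≤ y → slope d r x z < slope d r x y

lemma slope_le_iff (hr : StrictMono r) {x y : L} (h : x < y) {c : ℝ} :
    slope d r x y ≤ c ↔ d y - c * r y ≤ d x - c * r x := by
  rw [slope, div_le_iff₀ (sub_pos.2 (hr h))]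
  constructor <;> intro h <;> linarith

lemma slope_lt_iff (hr : StrictMono r) {x y : L} (h : x < y) {c : ℝ} :
    slope d r x y < c ↔ d y - c * r y < d x - c * r x := by
  rw [slope, div_lt_iff₀ (sub_pos.2 (hr h))]
  constructor <;> intro h <;> linarith

lemma slope_mul (hr : StrictMono r) {x y : L} (h : x < y) :
    slope d r x y * (r y - r x) = d y - d x :=
  div_mul_cancel₀ _ (sub_pos.2 (hr h)).ne'

lemma IsMaxDestabilizing.unique {x y y' : L} (h : IsMaxDestabilizing d r x y)
    (h' : IsMaxDestabilizing d r x y') : y = y' := by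
  have key : ∀ {a b : L}, IsMaxDestabilizing d r x a → IsMaxDestabilizing d r x b → a ≤ b := by
    intro a b ha hb
    by_contra hab
    have h1 := hb.2 a ha.1.1 hab
    by_cases hba : b ≤ a
    · exact (ha.1.2 b hb.1.1 hba).not_gt h1
    · exact (ha.2 b hb.1.1 hba).not_gt h1
  exact le_antisymm (key h h') (key h' h)

lemma IsMaxDestabilizing.slope_lt (hr : StrictMono r) {x y z : L}
    (h : IsMaxDestabilizing d r x y) (hyz : y < z) : slope d r y z < slope d r x y := by
  have h1 := h.2 z (h.1.1.trans hyz) hyz.not_ge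
  rw [slope_lt_iff hr (h.1.1.trans hyz)] at h1
  rw [slope_lt_iff hr hyz]
  have := slope_mul (d := d) hr h.1.1
  linarith

lemma exists_isMaxDestabilizing [OrderTop L] [WellFoundedLT L] [WellFoundedGT L]
    (hd : ∀ a b, d (a ⊔ b) + d (a ⊓ b) = d a + d b)
    (hrk : ∀ a b, r (a ⊔ b) + r (a ⊓ b) = r a + r b) (hr : StrictMono r)
    {x : L} (hx : x < ⊤) : ∃ y, IsMaxDestabilizing d r x y := by
  obtain ⟨y, ⟨hxy, hy⟩, hmin⟩ := WellFounded.has_min (wellFounded_lt (α := L))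
    {y | x < y ∧ ∀ z, y < z → slope d r x z < slope d r x y}
    ⟨⊤, hx, fun z hz => absurd hz not_top_lt⟩
  have hLy := slope_mul (d := d) hr hxy
  have below : ∀ q, x < q → q ≤ y → slope d r x q ≤ slope d r x y := by
    by_contra! hcon
    obtain ⟨q, ⟨hxq, hqy, hq⟩, hqmax⟩ := WellFounded.has_min (wellFounded_gt (α := L))
      {q | x < q ∧ q ≤ y ∧ slope d r x y < slope d r x q} hcon
    obtain ⟨t, ⟨hqt, ht⟩, htmax⟩ := WellFounded.has_min (wellFounded_gt (α := L))
      {t | q ≤ t ∧ slope d r x q ≤ slope d r x t} ⟨q, le_rfl, le_rfl⟩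
    have hxt := hxq.trans_le hqt
    have hty : ¬ t ≤ y := by
      intro hty
      refine hmin t ⟨hxt, fun z hz => ?_⟩ (lt_of_le_of_ne hty ?_)
      · by_contra! hz'
        exact htmax z ⟨hqt.trans hz.le, ht.trans hz'⟩ hz
      · rintro rfl
        exact absurd ht hq.not_ge
    have hyt : y < y ⊔ t := left_lt_sup.2 hty
    have h1 := (slope_lt_iff hr (hxy.trans hyt)).1 (hy _ hyt)
    have hqm : q ≤ y ⊓ t := le_inf hqy hqt
    have hxm := hxq.trans_le hqm
    have hm : slope d r x t < slope d r x (y ⊓ t) := by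
      by_contra! hm
      rw [slope_le_iff hr hxm] at hm
      have h2 := slope_mul (d := d) hr hxt
      have h3 := hd y t
      have h4 := congrArg (slope d r x t * ·) (hrk y t)
      simp only [mul_add] at h4
      have h5 : 0 < r (y ⊔ t) - r y := sub_pos.2 (hr hyt)
      nlinarith [mul_pos (sub_pos.2 (hq.trans_le ht)) h5]
    rcases hqm.eq_or_lt with h | h
    · rw [← h] at hm
      exact ht.not_gt hm
    · exact hqmax _ ⟨hxm, inf_le_left, hq.trans_le (ht.trans hm.le)⟩ h
  refine ⟨y, ⟨hxy, below⟩, fun q hxq hqy => ?_⟩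
  have hyt : y < y ⊔ q := left_lt_sup.2 hqy
  have h1 := (slope_lt_iff hr (hxy.trans hyt)).1 (hy _ hyt)
  have h2 : d (y ⊓ q) - slope d r x y * r (y ⊓ q) ≤ d x - slope d r x y * r x := by
    rcases (le_inf hxy.le hxq.le).eq_or_lt with h | h
    · rw [← h]
    · exact (slope_le_iff hr h).1 (below _ h inf_le_left)
  by_contra! hcon
  have h3 : d x - slope d r x y * r x ≤ d q - slope d r x y * r q := by
    have := slope_mul (d := d) hr hxq
    nlinarith [mul_nonneg (sub_nonneg.2 hcon) (sub_pos.2 (hr hxq)).le]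
  have h4 := hd y q
  have h5 := congrArg (slope d r x y * ·) (hrk y q)
  simp only [mul_add] at h5
  linarith

/-- A chain each of whose steps is the maximal destabilizing one. -/
def IsMaxDestabilizingChain (d r : L → ℝ) (n : ℕ) (F : Fin (n + 1) → L) : Prop :=
  ∀ i : Fin n, IsMaxDestabilizing d r (F i.castSucc) (F i.succ)

lemma exists_isMaxDestabilizingChain [OrderTop L] [WellFoundedLT L] [WellFoundedGT L]
    (hd : ∀ a b, d (a ⊔ b) + d (a ⊓ b) = d a + d b)
    (hrk : ∀ a b, r (a ⊔ b) + r (a ⊓ b) = r a + r b) (hr : StrictMono r) (x : L) :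
    ∃ P : Σ n : ℕ, Fin (n + 1) → L,
      P.2 0 = x ∧ P.2 (Fin.last _) = ⊤ ∧ IsMaxDestabilizingChain d r P.1 P.2 := by
  induction x using (wellFounded_gt (α := L)).induction with
  | _ x ih =>
    rcases eq_or_ne x ⊤ with rfl | hx
    · exact ⟨⟨0, fun _ => ⊤⟩, rfl, rfl, fun i => i.elim0⟩
    · obtain ⟨y, hy⟩ := exists_isMaxDestabilizing hd hrk hr (lt_top_iff_ne_top.2 hx)
      obtain ⟨⟨n, F⟩, h0, h1, hF⟩ := ih y hy.1.1
      refine ⟨⟨n + 1, Fin.cons x F⟩, rfl, ?_, fun i => ?_⟩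
      · simpa [← Fin.succ_last] using h1
      · refine Fin.cases ?_ (fun i => ?_) i
        · have h0 : F 0 = y := h0
          simpa [h0] using hy
        · simpa [← Fin.succ_castSucc] using hF i

lemma IsMaxDestabilizingChain.unique [OrderTop L] {n m : ℕ} {F : Fin (n + 1) → L}
    {G : Fin (m + 1) → L} (hF : IsMaxDestabilizingChain d r n F)
    (hG : IsMaxDestabilizingChain d r m G) (hF1 : F (Fin.last n) = ⊤)
    (hG1 : G (Fin.last m) = ⊤) (h0 : F 0 = G 0) :
    (⟨n, F⟩ : Σ n : ℕ, Fin (n + 1) → L) = ⟨m, G⟩ := by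
  induction n generalizing m with
  | zero =>
    cases m with
    | zero =>
      congr 1
      funext i
      rw [Fin.fin_one_eq_zero i, h0]
    | succ m =>
      have h : G 0 < _ := (hG 0).1.1
      rw [← h0] at h
      exact absurd (hF1 ▸ h) not_top_lt
  | succ n ih =>
    cases m with
    | zero =>
      have h : F 0 < _ := (hF 0).1.1
      rw [h0] at h
      exact absurd (hG1 ▸ h) not_top_lt
    | succ m =>
      have h1 : F 1 = G 1 := by
        have hG0 : IsMaxDestabilizing d r (G 0) (G 1) := hG 0
        rw [← h0] at hG0
        exact (hF 0).unique hG0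
      have h := ih (m := m) (F := Fin.tail F) (G := Fin.tail G)
        (fun i => hF i.succ) (fun i => hG i.succ) hF1 hG1 h1
      obtain ⟨rfl, h⟩ := Sigma.mk.inj_iff.1 h
      congr 1
      rw [← Fin.cons_self_tail F, ← Fin.cons_self_tail G, h0, eq_of_heq h]

/-- A chain with semistable steps of strictly decreasing slopes. -/
def IsSemistableChain (d r : L → ℝ) (n : ℕ) (F : Fin (n + 1) → L) : Prop :=
  (∀ i : Fin n, IsSemistable d r (F i.castSucc) (F i.succ)) ∧
  ∀ i j : Fin n, i < j →
    slope d r (F j.castSucc) (F j.succ) < slope d r (F i.castSucc) (F i.succ)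

lemma IsSemistableChain.strictMono {n : ℕ} {F : Fin (n + 1) → L}
    (hF : IsSemistableChain d r n F) : StrictMono F :=
  Fin.strictMono_iff_lt_succ.2 fun i => (hF.1 i).1

lemma IsMaxDestabilizingChain.isSemistableChain (hr : StrictMono r) {n : ℕ} {F : Fin (n + 1) → L}
    (hF : IsMaxDestabilizingChain d r n F) : IsSemistableChain d r n F := by
  refine ⟨fun i => (hF i).1, ?_⟩
  cases n with
  | zero => exact fun i => i.elim0
  | succ n =>
    have : StrictAnti fun i : Fin (n + 1) => slope d r (F i.castSucc) (F i.succ) :=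
      Fin.strictAnti_iff_succ_lt.2 fun i => by
        exact (hF i.castSucc).slope_lt hr (hF i.succ).1.1
    exact fun i j hij => this hij

lemma IsSemistableChain.isMaxDestabilizingChain [OrderTop L]
    (hd : ∀ a b, d (a ⊔ b) + d (a ⊓ b) = d a + d b)
    (hrk : ∀ a b, r (a ⊔ b) + r (a ⊓ b) = r a + r b) (hr : StrictMono r)
    {n : ℕ} {F : Fin (n + 1) → L} (hF : IsSemistableChain d r n F) (h1 : F (Fin.last n) = ⊤) :
    IsMaxDestabilizingChain d r n F := by
  intro i
  refine ⟨hF.1 i, fun q hq hqi => ?_⟩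
  set c := slope d r (F i.castSucc) (F i.succ) with hc
  have key : ∀ j : Fin (n + 1), i.succ ≤ j →
      d (q ⊓ F j) - c * r (q ⊓ F j) ≤ d (F i.castSucc) - c * r (F i.castSucc) ∧
      (d (F i.castSucc) - c * r (F i.castSucc) ≤ d (q ⊓ F j) - c * r (q ⊓ F j) →
        q ⊓ F j ≤ F i.succ) := by
    intro j
    induction j using Fin.induction with
    | zero => exact fun h => absurd h (Fin.succ_pos i).not_ge
    | succ j ih =>
      intro hij
      rcases hij.eq_or_lt with hij | hij
      · rw [← hij]
        refine ⟨?_, fun _ => inf_le_right⟩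
        rcases (le_inf hq.le (hF.1 i).1.le).eq_or_lt with h | h
        · rw [← h]
        · exact (slope_le_iff hr h).1 ((hF.1 i).2 _ h inf_le_right)
      · have hij' : i < j := Fin.succ_lt_succ_iff.1 hij
        obtain ⟨ih1, ih2⟩ := ih (Fin.succ_le_castSucc_iff.2 hij')
        set s := q ⊓ F j.succ with hs
        have hj : F j.castSucc < F j.succ := (hF.1 j).1
        have hinf : s ⊓ F j.castSucc = q ⊓ F j.castSucc := by
          rw [hs, inf_assoc, inf_eq_right.2 hj.le]
        by_cases hsj : s ≤ F j.castSucc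
        · rw [inf_eq_left.2 hsj] at hinf
          rw [hinf]
          exact ⟨ih1, ih2⟩
        · have hlt : F j.castSucc < s ⊔ F j.castSucc := right_lt_sup.2 hsj
          have h2 := (slope_lt_iff hr hlt).1
            (((hF.1 j).2 _ hlt (sup_le inf_le_right hj.le)).trans_lt (hF.2 i j hij'))
          have h3 := hd s (F j.castSucc)
          have h4 := congrArg (c * ·) (hrk s (F j.castSucc))
          rw [hinf] at h3 h4
          simp only [mul_add] at h4
          rw [← hc] at h2
          exact ⟨by linarith, fun h => by linarith⟩
  have h := key (Fin.last n) (Fin.le_last _)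
  rw [h1, inf_top_eq] at h
  rw [slope_lt_iff hr hq]
  by_contra! hcon
  exact hqi (h.2 hcon)

theorem existsUnique_isSemistableChain [BoundedOrder L] [WellFoundedLT L] [WellFoundedGT L]
    (hd : ∀ a b, d (a ⊔ b) + d (a ⊓ b) = d a + d b)
    (hrk : ∀ a b, r (a ⊔ b) + r (a ⊓ b) = r a + r b) (hr : StrictMono r) :
    ∃! P : Σ n : ℕ, Fin (n + 1) → L,
      P.2 0 = ⊥ ∧ P.2 (Fin.last _) = ⊤ ∧ IsSemistableChain d r P.1 P.2 := by
  obtain ⟨P, h0, h1, hP⟩ := exists_isMaxDestabilizingChain hd hrk hr (⊥ : L)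
  refine ⟨P, ⟨h0, h1, hP.isSemistableChain hr⟩, ?_⟩
  rintro Q ⟨hQ0, hQ1, hQ⟩
  exact (hQ.isMaxDestabilizingChain hd hrk hr hQ1).unique hP hQ1 h1 (hQ0.trans h0.symm)

end Lattice

lemma arg_le_arg_iff {z w : ℂ} (hz : 0 < z.im) (hw : 0 < w.im) :
    z.arg ≤ w.arg ↔ -z.re / z.im ≤ -w.re / w.im := by
  have hz0 : 0 < ‖z‖ := norm_pos_iff.2 fun h => by simp [h] at hz
  have hw0 : 0 < ‖w‖ := norm_pos_iff.2 fun h => by simp [h] at hw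
  have hsin : ‖z‖ * ‖w‖ * Real.sin (w.arg - z.arg) = w.im * z.re - w.re * z.im := by
    rw [Real.sin_sub]
    linear_combination ‖z‖ * Real.cos z.arg * norm_mul_sin_arg w + w.im * norm_mul_cos_arg z -
      ‖z‖ * Real.sin z.arg * norm_mul_cos_arg w - w.re * norm_mul_sin_arg z
  have hz1 := arg_nonneg_iff.2 hz.le
  have hw1 := arg_nonneg_iff.2 hw.le
  have hz2 := arg_lt_pi_iff.2 (.inr hz.ne')
  have hw2 := arg_lt_pi_iff.2 (.inr hw.ne')
  have hle : -z.re / z.im ≤ -w.re / w.im ↔ 0 ≤ w.im * z.re - w.re * z.im := by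
    rw [div_le_div_iff₀ hz hw]
    constructor <;> intro h <;> linarith
  rw [hle, ← hsin]
  constructor
  · intro h
    exact mul_nonneg (mul_pos hz0 hw0).le
      (Real.sin_nonneg_of_nonneg_of_le_pi (by linarith) (by linarith))
  · intro h
    by_contra! hlt
    have := Real.sin_neg_of_neg_of_neg_pi_lt (x := w.arg - z.arg) (by linarith) (by linarith)
    exact absurd h (mul_neg_of_pos_of_neg (mul_pos hz0 hw0) this).not_ge

section Module

open StabilityFunction

variable (σ : StabilityFunction R) {M : Type} [AddCommGroup M] [Module ℂ M] [Module R M]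
  [IsScalarTower ℂ R M] [FiniteDimensional ℂ M]

lemma Z_quotient (p : Submodule R M) : σ.Z (M ⧸ p) = σ.Z M - σ.Z p := by
  rw [σ.additive p M (M ⧸ p) p.subtype p.mkQ p.injective_subtype p.mkQ_surjective (by simp)]
  ring

lemma Z_comap_subtype {p q : Submodule R M} (h : p ≤ q) :
    σ.Z (p.comap q.subtype) = σ.Z p :=
  σ.iso_invariant _ _ (Submodule.comapSubtypeEquivOfLe h)

lemma Z_subfactor {p q : Submodule R M} (h : p ≤ q) :
    σ.Z (subfactor p q) = σ.Z q - σ.Z p := by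
  rw [Z_quotient, Z_comap_subtype σ h]

lemma Z_sup_add_Z_inf (p q : Submodule R M) :
    σ.Z ↥(p ⊔ q) + σ.Z ↥(p ⊓ q) = σ.Z p + σ.Z q := by
  have h := σ.iso_invariant _ _ (LinearMap.quotientInfEquivSupQuotient p q)
  have h1 := Z_subfactor σ (inf_le_left : p ⊓ q ≤ p)
  have h2 := Z_subfactor σ (le_sup_right : q ≤ p ⊔ q)
  have h3 : σ.Z ↥p - σ.Z ↥(p ⊓ q) = σ.Z ↥(p ⊔ q) - σ.Z ↥q := h1.symm.trans (h.trans h2)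
  linear_combination -h3

lemma nontrivial_subfactor_iff {p q : Submodule R M} (h : p ≤ q) :
    Nontrivial (subfactor p q) ↔ p < q := by
  rw [Submodule.Quotient.nontrivial_iff, Ne, Submodule.comap_subtype_eq_top, lt_iff_le_not_ge]
  exact ⟨fun hn => ⟨h, hn⟩, And.right⟩

lemma im_sub_pos {p q : Submodule R M} (h : p < q) : 0 < (σ.Z q - σ.Z p).im := by
  rw [← Z_subfactor σ h.le]
  exact σ.upperHalf _ ((nontrivial_subfactor_iff h.le).2 h)

lemma strictMono_im_Z : StrictMono fun p : Submodule R M => (σ.Z p).im := fun p q h => by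
  simpa using im_sub_pos σ h

lemma arg_sub_le_arg_sub_iff {p q p' q' : Submodule R M} (h : p < q) (h' : p' < q') :
    (σ.Z q - σ.Z p).arg ≤ (σ.Z q' - σ.Z p').arg ↔
      slope (fun p : Submodule R M => -(σ.Z p).re) (fun p => (σ.Z p).im) p q ≤
      slope (fun p : Submodule R M => -(σ.Z p).re) (fun p => (σ.Z p).im) p' q' := by
  rw [arg_le_arg_iff (im_sub_pos σ h) (im_sub_pos σ h')]
  simp only [slope, sub_re, sub_im, neg_sub_neg, neg_sub]

lemma phase_subfactor_le_iff {p q p' q' : Submodule R M} (h : p < q) (h' : p' < q') :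
    σ.phase (subfactor p q) ≤ σ.phase (subfactor p' q') ↔
      slope (fun p : Submodule R M => -(σ.Z p).re) (fun p => (σ.Z p).im) p q ≤
      slope (fun p : Submodule R M => -(σ.Z p).re) (fun p => (σ.Z p).im) p' q' := by
  rw [phase, phase, div_le_div_iff_of_pos_right Real.pi_pos, Z_subfactor σ h.le,
    Z_subfactor σ h'.le, arg_sub_le_arg_sub_iff σ h h']

lemma Z_submodule_quotient (p : Submodule R M) (A : Submodule R (M ⧸ p)) :
    σ.Z A = σ.Z (A.comap p.mkQ) - σ.Z p := by
  have hp : p ≤ A.comap p.mkQ := fun x hx => by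
    simp [(Submodule.Quotient.mk_eq_zero p).2 hx]
  rw [σ.additive p (A.comap p.mkQ) A (Submodule.inclusion hp)
    (p.mkQ.restrict (p := A.comap p.mkQ) (q := A) fun _ hx => hx)
    (Submodule.inclusion_injective hp)]
  · ring
  · rintro ⟨a, ha⟩
    obtain ⟨x, rfl⟩ := p.mkQ_surjective a
    exact ⟨⟨x, ha⟩, rfl⟩
  · ext ⟨x, hx⟩
    simp [Submodule.range_inclusion, LinearMap.restrict_apply]

lemma isSemistable_subfactor_iff {p q : Submodule R M} (h : p ≤ q) :
    σ.IsSemistable (subfactor p q) ↔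
      IsSemistable (fun p : Submodule R M => -(σ.Z p).re) (fun p => (σ.Z p).im) p q := by
  rw [StabilityFunction.IsSemistable, IsSemistable, nontrivial_subfactor_iff h]
  refine and_congr_right fun hpq => ?_
  have hphase : ∀ {A : Submodule R (subfactor p q)} {s : Submodule R M}, s ≤ q → p < s →
      A.comap (p.comap q.subtype).mkQ = s.comap q.subtype →
      (σ.phase A ≤ σ.phase (subfactor p q) ↔
        slope (fun p : Submodule R M => -(σ.Z p).re) (fun p => (σ.Z p).im) p s ≤
        slope (fun p : Submodule R M => -(σ.Z p).re) (fun p => (σ.Z p).im) p q) := by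
    intro A s hsq hps hA
    rw [phase, phase, div_le_div_iff_of_pos_right Real.pi_pos, Z_submodule_quotient, hA,
      Z_comap_subtype σ h, Z_comap_subtype σ hsq, Z_subfactor σ h, arg_sub_le_arg_sub_iff σ hps hpq]
  constructor
  · intro H s hps hsq
    have hA : ((s.comap q.subtype).map (p.comap q.subtype).mkQ).comap (p.comap q.subtype).mkQ =
        s.comap q.subtype := by
      rw [Submodule.comap_map_mkQ, sup_eq_right]
      exact Submodule.comap_mono hps.le
    refine (hphase hsq hps hA).1 (H _ fun hbot => ?_)
    rw [hbot, Submodule.comap_bot, Submodule.ker_mkQ] at hA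
    refine hps.not_ge fun x hx => ?_
    have : (⟨x, hsq hx⟩ : q) ∈ s.comap q.subtype := hx
    rw [← hA] at this
    exact this
  · intro H A hA0
    set s := (A.comap (p.comap q.subtype).mkQ).map q.subtype with hs
    have hsq : s ≤ q := Submodule.map_subtype_le _ _
    have hA : A.comap (p.comap q.subtype).mkQ = s.comap q.subtype :=
      (Submodule.comap_map_eq_of_injective q.injective_subtype _).symm
    have hle : p.comap q.subtype ≤ A.comap (p.comap q.subtype).mkQ := Submodule.le_comap_mkQ _ _
    have hps : p ≤ s := by
      have := Submodule.map_mono (f := q.subtype) hle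
      rwa [Submodule.map_comap_subtype, inf_eq_right.2 h] at this
    have hne : p ≠ s := by
      rintro hps
      refine hA0 ?_
      rw [← hps] at hA
      have := Submodule.map_comap_eq_of_surjective (p.comap q.subtype).mkQ_surjective A
      rw [← this, hA, Submodule.mkQ_map_self]
    have hps := lt_of_le_of_ne hps hne
    exact (hphase hsq hps hA).2 (H s hps hsq)

lemma isHNFiltration_iff {n : ℕ} {F : Fin (n + 1) → Submodule R M} :
    σ.IsHNFiltration n F ↔ F 0 = ⊥ ∧ F (Fin.last n) = ⊤ ∧
      IsSemistableChain (fun p : Submodule R M => -(σ.Z p).re) (fun p => (σ.Z p).im) n F := by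
  have key : StrictMono F → ∀ i j : Fin n,
      (σ.phase (subfactor (F j.castSucc) (F j.succ)) <
        σ.phase (subfactor (F i.castSucc) (F i.succ)) ↔
      slope (fun p : Submodule R M => -(σ.Z p).re) (fun p => (σ.Z p).im)
          (F j.castSucc) (F j.succ) <
        slope (fun p : Submodule R M => -(σ.Z p).re) (fun p => (σ.Z p).im)
          (F i.castSucc) (F i.succ)) := fun hF i j => by
    rw [← not_le, ← not_le, phase_subfactor_le_iff σ (hF i.castSucc_lt_succ)
      (hF j.castSucc_lt_succ)]
  constructor
  · rintro ⟨h0, h1, hF, hs, hlt⟩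
    exact ⟨h0, h1, fun i => (isSemistable_subfactor_iff σ (hF i.castSucc_lt_succ).le).1 (hs i),
      fun i j hij => (key hF i j).1 (hlt i j hij)⟩
  · rintro ⟨h0, h1, h⟩
    have hF := h.strictMono
    exact ⟨h0, h1, hF,
      fun i => (isSemistable_subfactor_iff σ (hF i.castSucc_lt_succ).le).2 (h.1 i),
      fun i j hij => (key hF i j).2 (h.2 i j hij)⟩

end Module

end HarderNarasimhan

/-- **Existence and uniqueness of Harder–Narasimhan filtrations**: for every
stability function `Z` and every nonzero module `M` there is a unique filtration
`0 = M₀ ⊂ M₁ ⊂ ⋯ ⊂ Mₙ = M` by submodules such that each successive factor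
`Fᵢ = Mᵢ/Mᵢ₋₁` is `Z`-semistable and `φ(F₁) > φ(F₂) > ⋯ > φ(Fₙ)`. -/
theorem harder_narasimhan_exists_unique [FiniteDimensional ℂ R]
    (σ : StabilityFunction R) (M : Type) [AddCommGroup M] [Module ℂ M] [Module R M]
    [IsScalarTower ℂ R M] [FiniteDimensional ℂ M] (hM : Nontrivial M) :
    ∃! P : Σ n : ℕ, Fin (n + 1) → Submodule R M, σ.IsHNFiltration P.1 P.2 := by
  have : IsArtinian R M := isArtinian_of_tower ℂ inferInstance
  have : IsNoetherian R M := isNoetherian_of_tower ℂ inferInstance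
  simp only [HarderNarasimhan.isHNFiltration_iff]
  refine HarderNarasimhan.existsUnique_isSemistableChain (fun p q => ?_) (fun p q => ?_)
    (HarderNarasimhan.strictMono_im_Z σ)
  · have h := congrArg re (HarderNarasimhan.Z_sup_add_Z_inf σ p q)
    simp only [add_re] at h
    linarith
  · simpa using congrArg im (HarderNarasimhan.Z_sup_add_Z_inf σ p q)
end

section
/- For a stability function Z, every nonzero module M contains a nonzero Z-semistable submodule A ⊆ M with φ(A) ≥ φ(M). -/
open Complex

variable {R : Type} [Ring R] [Algebra ℂ R]

/-- Isomorphic modules have equal phases. -/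
theorem StabilityFunction.phase_congr (σ : StabilityFunction R) {V W : Type}
    [AddCommGroup V] [Module ℂ V] [Module R V] [IsScalarTower ℂ R V] [FiniteDimensional ℂ V]
    [AddCommGroup W] [Module ℂ W] [Module R W] [IsScalarTower ℂ R W] [FiniteDimensional ℂ W]
    (e : V ≃ₗ[R] W) : σ.phase V = σ.phase W := by
  rw [StabilityFunction.phase, StabilityFunction.phase, σ.iso_invariant V W e]

/-- For a stability function `Z`, every nonzero module `M` contains a nonzero
`Z`-semistable submodule `A ⊆ M` with `φ(A) ≥ φ(M)`. -/
theorem exists_semistable_submodule [FiniteDimensional ℂ R] (σ : StabilityFunction R)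
    (M : Type)
    [AddCommGroup M] [Module ℂ M] [Module R M] [IsScalarTower ℂ R M] [FiniteDimensional ℂ M]
    (hM : Nontrivial M) :
    ∃ A : Submodule R M, A ≠ ⊥ ∧ σ.IsSemistable A ∧ σ.phase M ≤ σ.phase A := by
  have hArt : IsArtinian R M := isArtinian_of_tower ℂ inferInstance
  have htop : σ.phase (⊤ : Submodule R M) = σ.phase M :=
    σ.phase_congr Submodule.topEquiv
  obtain ⟨A, ⟨hA, hMA⟩, hmin⟩ := WellFounded.has_min (wellFounded_lt (α := Submodule R M))
    {A | A ≠ ⊥ ∧ σ.phase M ≤ σ.phase A} ⟨⊤, top_ne_bot, htop.ge⟩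
  refine ⟨A, hA, ⟨Submodule.nontrivial_iff_ne_bot.mpr hA, fun B hB => ?_⟩, hMA⟩
  by_contra! hAB
  have hphase : σ.phase B = σ.phase (B.map A.subtype) :=
    σ.phase_congr (Submodule.equivMapOfInjective A.subtype A.injective_subtype B)
  have hne : B.map A.subtype ≠ ⊥ := fun h =>
    hB (Submodule.map_injective_of_injective A.injective_subtype
      (h.trans (Submodule.map_bot _).symm))
  have hlt : B.map A.subtype ≠ A := fun h => by
    rw [h] at hphase
    exact hAB.ne' hphase
  exact hmin _ ⟨hne, hMA.trans (hAB.le.trans hphase.le)⟩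
    (lt_of_le_of_ne (Submodule.map_subtype_le A B) hlt)
end

section
/- Reineke's inversion formula: let δ be any function assigning to each nonzero γ ∈ ℕ^N an element δ_γ ∈ A. Define κ_γ = Σ_{n≥1} Σ δ_{γ₁}·…·δ_{γₙ}, where the inner (finite) sum is over all tuples (γ₁,…,γₙ) of nonzero elements of ℕ^N with γ₁+⋯+γₙ = γ and strictly decreasing phases φ(γ₁) > φ(γ₂) > ⋯ > φ(γₙ). Then for every nonzero γ ∈ ℕ^N one has δ_γ = Σ_{n≥1} (−1)^{n−1} Σ κ_{γ₁}·…·κ_{γₙ}, where the inner (finite) sum is over all tuples (γ₁,…,γₙ) of nonzero elements of ℕ^N with γ₁+⋯+γₙ = γ and φ(γ₁+⋯+γᵢ) > φ(γ) for all 1 ≤ i ≤ n−1. -/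
open Complex

/-- The phase `φ(γ) = (1/π)·arg Z(γ) ∈ (0,1)` of a nonzero class `γ ∈ ℕ^N`. -/
noncomputable def latticePhase {N : ℕ} (Z : (Fin N → ℤ) →+ ℂ) (γ : Fin N → ℕ) : ℝ :=
  (Z fun i => (γ i : ℤ)).arg / Real.pi

namespace ReinekeInversion

open scoped Classical in
/-- The Iverson bracket of a proposition. -/
noncomputable def iverson (p : Prop) : ℤ := if p then 1 else 0

@[simp] lemma iverson_true : iverson True = 1 := if_pos trivial

@[simp] lemma iverson_false : iverson False = 0 := if_neg not_false

open scoped Classical in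
lemma iverson_smul {A : Type*} [AddCommGroup A] (p : Prop) (x : A) :
    iverson p • x = if p then x else 0 := by
  by_cases hp : p <;> simp [hp]

lemma iverson_and (p q : Prop) : iverson (p ∧ q) = iverson p * iverson q := by
  by_cases hp : p <;> simp [hp]

section Compositions

variable {N : ℕ}

/-- The pairs `(a, b)` with `a ≠ 0` and `a + b = r`. -/
def splittings (r : Fin N → ℕ) : Finset ((Fin N → ℕ) × (Fin N → ℕ)) :=
  {p ∈ Finset.Iic r ×ˢ Finset.Iic r | p.1 + p.2 = r ∧ p.1 ≠ 0}

lemma mem_splittings {r : Fin N → ℕ} {p : (Fin N → ℕ) × (Fin N → ℕ)} :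
    p ∈ splittings r ↔ p.1 + p.2 = r ∧ p.1 ≠ 0 := by
  simp only [splittings, Finset.mem_filter, Finset.mem_product, Finset.mem_Iic,
    and_iff_right_iff_imp]
  rintro ⟨rfl, -⟩
  exact ⟨le_self_add, le_add_self⟩

lemma finite_compositions (r : Fin N → ℕ) :
    {L : List (Fin N → ℕ) | (∀ x ∈ L, x ≠ 0) ∧ L.sum = r}.Finite := by
  induction r using WellFoundedLT.induction with
  | ind r ih =>
    have hfin : ({[]} ∪ ⋃ p ∈ splittings r, Set.image (fun L => p.1 :: L)
        {L : List (Fin N → ℕ) | (∀ x ∈ L, x ≠ 0) ∧ L.sum = p.2}).Finite := by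
      refine (Set.finite_singleton _).union (Set.Finite.biUnion (Finset.finite_toSet _) ?_)
      rintro ⟨a, b⟩ hp
      simp only [Finset.mem_coe, mem_splittings] at hp
      obtain ⟨rfl, ha⟩ := hp
      exact (ih b (lt_add_of_pos_left b (pos_iff_ne_zero.2 ha))).image _
    refine hfin.subset ?_
    rintro (_ | ⟨a, L⟩) ⟨h0, hs⟩
    · simp
    · right
      simp only [List.mem_cons, forall_eq_or_imp, List.sum_cons] at h0 hs
      simp only [Set.mem_iUnion]
      exact ⟨(a, L.sum), by simp [mem_splittings, hs, h0.1], L, ⟨h0.2, rfl⟩, rfl⟩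

/-- The finset of lists of nonzero vectors with sum `r`. -/
noncomputable def compositions (r : Fin N → ℕ) : Finset (List (Fin N → ℕ)) :=
  (finite_compositions r).toFinset

lemma mem_compositions {r : Fin N → ℕ} {L : List (Fin N → ℕ)} :
    L ∈ compositions r ↔ (∀ x ∈ L, x ≠ 0) ∧ L.sum = r := by
  simp [compositions]

lemma ne_nil_of_mem_compositions {r : Fin N → ℕ} (hr : r ≠ 0) {L : List (Fin N → ℕ)}
    (hL : L ∈ compositions r) : L ≠ [] := by
  rintro rfl
  exact hr (mem_compositions.1 hL).2.symm

lemma singleton_mem_compositions {r : Fin N → ℕ} (hr : r ≠ 0) : [r] ∈ compositions r := by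
  simp [mem_compositions, hr]

lemma compositions_zero : compositions (0 : Fin N → ℕ) = {[]} := by
  ext L
  rw [mem_compositions, Finset.mem_singleton]
  refine ⟨fun ⟨h, hs⟩ => ?_, fun h => by simp [h]⟩
  rw [List.eq_nil_iff_forall_not_mem]
  exact fun x hx => h x hx (List.sum_eq_zero_iff.1 hs x hx)

lemma finsum_eq_sum_compositions {A : Type*} [AddCommGroup A] {r : Fin N → ℕ} (hr : r ≠ 0)
    (p : List (Fin N → ℕ) → Prop) (f : List (Fin N → ℕ) → A) :
    ∑ᶠ L ∈ {L : List (Fin N → ℕ) | L ≠ [] ∧ (∀ x ∈ L, x ≠ 0) ∧ L.sum = r ∧ p L}, f L =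
      ∑ L ∈ compositions r, iverson (p L) • f L := by
  classical
  simp only [iverson_smul]
  rw [← Finset.sum_filter, ← finsum_mem_coe_finset]
  have : {L : List (Fin N → ℕ) | L ≠ [] ∧ (∀ x ∈ L, x ≠ 0) ∧ L.sum = r ∧ p L} =
      ↑({L ∈ compositions r | p L}) := by
    ext L
    simp only [Set.mem_ofPred_eq, Finset.coe_filter, mem_compositions, and_assoc]
    refine ⟨fun h => h.2, fun h => ⟨?_, h⟩⟩
    rintro rfl
    exact hr h.2.1.symm
  rw [this]

lemma sum_compositions_eq_sum_cons {A : Type*} [AddCommMonoid A] {r : Fin N → ℕ} (hr : r ≠ 0)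
    (f : List (Fin N → ℕ) → A) :
    ∑ L ∈ compositions r, f L = ∑ p ∈ splittings r,
      ∑ L ∈ compositions p.2, f (p.1 :: L) := by
  rw [Finset.sum_sigma']
  symm
  refine Finset.sum_nbij (fun x => x.1.1 :: x.2) ?_ ?_ ?_ (fun _ _ => rfl)
  · rintro ⟨⟨a, b⟩, L⟩ h
    simp only [Finset.mem_sigma, mem_splittings, mem_compositions] at h
    obtain ⟨⟨rfl, ha⟩, hL, rfl⟩ := h
    simpa [mem_compositions, ha] using hL
  · rintro ⟨⟨a, b⟩, L⟩ h ⟨⟨c, d⟩, M⟩ hM e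
    simp only [Finset.coe_sigma, Set.mem_sigma_iff, Finset.mem_coe, mem_compositions] at h hM
    simp only [List.cons.injEq] at e
    obtain ⟨rfl, rfl⟩ := e
    obtain ⟨-, -, rfl⟩ := h
    obtain ⟨-, -, rfl⟩ := hM
    rfl
  · intro L hL
    have hne := ne_nil_of_mem_compositions hr hL
    rw [Finset.mem_coe, mem_compositions] at hL
    obtain ⟨a, L, rfl⟩ := List.exists_cons_of_ne_nil hne
    simp only [List.mem_cons, forall_eq_or_imp, List.sum_cons] at hL
    refine ⟨⟨(a, L.sum), L⟩, ?_, rfl⟩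
    exact Finset.mem_sigma.2 ⟨mem_splittings.2 ⟨hL.2, hL.1.1⟩, mem_compositions.2 ⟨hL.1.2, rfl⟩⟩

lemma sum_compositions_eq_sum_append {A : Type*} [AddCommMonoid A] (r : Fin N → ℕ)
    (g : List (Fin N → ℕ) → List (Fin N → ℕ) → A) :
    ∑ p ∈ splittings r,
      ∑ L ∈ compositions p.1, ∑ M ∈ compositions p.2, g L M =
    ∑ L ∈ compositions r, ∑ i ∈ Finset.range L.length, g (L.take (i + 1)) (L.drop (i + 1)) := by
  simp only [← Finset.sum_product']
  rw [Finset.sum_sigma', Finset.sum_sigma']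
  symm
  refine Finset.sum_nbij' (fun x => ⟨((x.1.take (x.2 + 1)).sum, (x.1.drop (x.2 + 1)).sum),
      x.1.take (x.2 + 1), x.1.drop (x.2 + 1)⟩)
    (fun y => ⟨y.2.1 ++ y.2.2, y.2.1.length - 1⟩) ?_ ?_ ?_ ?_ (fun _ _ => rfl)
  · rintro ⟨L, i⟩ h
    simp only [Finset.mem_sigma, mem_compositions, Finset.mem_range] at h
    obtain ⟨⟨h0, rfl⟩, hi⟩ := h
    simp only [Finset.mem_sigma, mem_splittings, Finset.mem_product,
      mem_compositions, and_true, List.sum_take_add_sum_drop, true_and]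
    refine ⟨fun h => ?_, fun x hx => h0 x (List.mem_of_mem_take hx),
      fun x hx => h0 x (List.mem_of_mem_drop hx)⟩
    obtain ⟨a, L, rfl⟩ := List.exists_cons_of_ne_nil (List.length_pos_iff.1 (Nat.zero_lt_of_lt hi))
    exact h0 a (by simp) (List.sum_eq_zero_iff.1 h a (by simp))
  · rintro ⟨⟨a, b⟩, L, M⟩ h
    simp only [Finset.mem_sigma, mem_splittings, Finset.mem_product,
      mem_compositions] at h
    obtain ⟨⟨rfl, ha⟩, ⟨hL, rfl⟩, hM, rfl⟩ := h
    have : L ≠ [] := by rintro rfl; exact ha rfl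
    have := List.length_pos_iff.2 this
    simp only [Finset.mem_sigma, mem_compositions, List.mem_append, List.sum_append,
      Finset.mem_range, List.length_append, and_true]
    exact ⟨fun x hx => hx.elim (hL x) (hM x), by omega⟩
  · rintro ⟨L, i⟩ h
    simp only [Finset.mem_sigma, mem_compositions, Finset.mem_range] at h
    have : min (i + 1) L.length - 1 = i := by omega
    simp [this]
  · rintro ⟨⟨a, b⟩, L, M⟩ h
    simp only [Finset.mem_sigma, mem_splittings, Finset.mem_product,
      mem_compositions] at h
    obtain ⟨⟨rfl, ha⟩, ⟨hL, rfl⟩, hM, rfl⟩ := h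
    have : L ≠ [] := by rintro rfl; exact ha rfl
    have : L.length - 1 + 1 = L.length := by have := List.length_pos_iff.2 this; omega
    simp [this]

end Compositions

lemma iverson_pairwise_cons_cons {G P : Type*} [LinearOrder P] (φ : G → P) (a b : G) (L : List G) :
    iverson ((a :: b :: L).Pairwise fun a b => φ b < φ a) =
      iverson (φ b < φ a) * iverson ((b :: L).Pairwise fun a b => φ b < φ a) := by
  rw [← iverson_and]
  congr 1
  refine propext ⟨fun h => ⟨List.rel_of_pairwise_cons h (by simp), h.of_cons⟩,
    fun h => List.pairwise_cons.2 ⟨fun x hx => ?_, h.2⟩⟩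
  rcases List.mem_cons.1 hx with rfl | hx
  · exact h.1
  · exact (List.rel_of_pairwise_cons h.2 hx).trans h.1

section Weights

variable {G P : Type*} [AddCommMonoid G] [LinearOrder P]

/-- The signed weight of a list of `κ`-factors following a prefix of total class `s`: the sign
`(-1)^(n-1)` if all interior partial sums satisfy `q`, and `0` otherwise. -/
noncomputable def blockWeight (q : G → Prop) : G → List G → ℤ
  | _, [] => 0
  | s, a :: L => iverson (L = []) - iverson (q (s + a)) * blockWeight q (s + a) L

/-- The coefficient of a product of `δ`-factors following a prefix of total class `s` after the
`κ`-factors have been expanded: every gap contributes a factor, which is the signed number of ways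
to place or leave out a block boundary there. -/
noncomputable def gapWeight (φ : G → P) (q : G → Prop) : G → List G → ℤ
  | _, [] => 0
  | _, [_] => 1
  | s, a :: b :: L => (iverson (φ b < φ a) - iverson (q (s + a))) *
      gapWeight φ q (s + a) (b :: L)

lemma blockWeight_eq (q : G → Prop) (s : G) {L : List G} (hL : L ≠ []) :
    blockWeight q s L = iverson (∀ i, 1 ≤ i → i < L.length → q (s + (L.take i).sum)) *
      (-1) ^ (L.length - 1) := by
  induction L generalizing s with
  | nil => exact absurd rfl hL
  | cons a L ih =>
    rcases L with _ | ⟨b, L⟩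
    · have : ∀ i, 1 ≤ i → i < [a].length → q (s + (List.take i [a]).sum) :=
        fun i _ hi => by simp at hi; omega
      rw [eq_true this]
      simp [blockWeight]
    · rw [blockWeight, ih (s + a) (by simp)]
      have key : (∀ i, 1 ≤ i → i < (a :: b :: L).length → q (s + ((a :: b :: L).take i).sum)) ↔
          q (s + a) ∧
            ∀ i, 1 ≤ i → i < (b :: L).length → q (s + a + ((b :: L).take i).sum) := by
        constructor
        · refine fun h => ⟨by simpa using h 1 le_rfl (by simp), fun i _ hi => ?_⟩
          simpa [add_assoc] using h (i + 1) (by omega) (by simpa using hi)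
        · rintro ⟨h, h'⟩ (_ | _ | i) hi hi'
          · omega
          · simpa using h
          · simpa [add_assoc] using h' (i + 1) (by omega) (by simpa using hi')
      rw [key, iverson_and]
      simp [pow_succ, mul_assoc]

lemma gapWeight_eq_sub_sum (φ : G → P) (q : G → Prop) (s : G) {L : List G} (hL : L ≠ []) :
    gapWeight φ q s L = iverson (L.Pairwise fun a b => φ b < φ a) -
      ∑ i ∈ Finset.range L.length, iverson ((L.take (i + 1)).Pairwise fun a b => φ b < φ a) *
        (iverson (q (s + (L.take (i + 1)).sum)) *
          gapWeight φ q (s + (L.take (i + 1)).sum) (L.drop (i + 1))) := by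
  induction L generalizing s with
  | nil => exact absurd rfl hL
  | cons a L ih =>
    rcases L with _ | ⟨b, L⟩
    · simp [gapWeight]
    · have := ih (s + a) (by simp)
      rw [gapWeight, List.length_cons, Finset.sum_range_succ', sub_mul]
      nth_rewrite 1 [this]
      simp only [List.take_succ_cons, List.drop_succ_cons, iverson_pairwise_cons_cons,
        List.take_zero, List.drop_zero, List.pairwise_singleton, iverson_true, one_mul,
        List.sum_cons, List.sum_nil, add_zero, ← add_assoc, mul_assoc, ← Finset.mul_sum]
      ring

section Vanishing

variable {φ : G → P} {h : G →+ ℝ} {t : P}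

lemma pos_of_gapWeight_ne_zero (hpos : ∀ x, t < φ x ↔ 0 < h x) {s a : G} {L : List G}
    (hw : gapWeight φ (0 < h ·) s (a :: L) ≠ 0) (ha : 0 < h a) (hs : 0 < h (s + a)) :
    0 < h (s + (a :: L).sum) := by
  induction L generalizing s a with
  | nil => simpa using hs
  | cons b L ih =>
    rw [gapWeight] at hw
    have hab : φ a ≤ φ b := by
      by_contra! hlt
      exact hw (by simp only [eq_true hlt, eq_true hs, sub_self, zero_mul])
    have hb : 0 < h b := (hpos b).1 (((hpos a).2 ha).trans_le hab)
    have := ih (right_ne_zero_of_mul hw) hb (by rw [map_add]; exact add_pos hs hb)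
    simpa [add_assoc] using this

lemma neg_of_gapWeight_ne_zero (hpos : ∀ x, t < φ x ↔ 0 < h x)
    (hneg : ∀ x, x ≠ 0 → φ x < t → h x < 0) {s a b : G} {L : List G}
    (h0 : ∀ x ∈ b :: L, x ≠ 0) (hw : gapWeight φ (0 < h ·) s (a :: b :: L) ≠ 0)
    (ha : h a ≤ 0) (hs : h (s + a) ≤ 0) : h (s + (a :: b :: L).sum) < 0 := by
  induction L generalizing s a b with
  | nil =>
    have hba : φ b < φ a := by
      by_contra hlt
      exact hw (by simp only [gapWeight, eq_false hlt, eq_false hs.not_gt, sub_self, zero_mul])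
    have hb := hneg b (h0 b (by simp)) (hba.trans_le (not_lt.1 ((hpos a).not.2 ha.not_gt)))
    have : h (s + a + b) < 0 := by rw [map_add]; exact add_neg_of_nonpos_of_neg hs hb
    simpa [add_assoc] using this
  | cons c L ih =>
    rw [gapWeight] at hw
    have hba : φ b < φ a := by
      by_contra hlt
      exact hw (by simp only [eq_false hlt, eq_false hs.not_gt, sub_self, zero_mul])
    have hb := hneg b (h0 b (by simp)) (hba.trans_le (not_lt.1 ((hpos a).not.2 ha.not_gt)))
    have := ih (s := s + a) (fun x hx => h0 x (List.mem_cons_of_mem _ hx))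
      (right_ne_zero_of_mul hw) hb.le (by rw [map_add]; exact add_nonpos hs hb.le)
    simpa [add_assoc] using this

lemma gapWeight_eq_zero (hpos : ∀ x, t < φ x ↔ 0 < h x)
    (hneg : ∀ x, x ≠ 0 → φ x < t → h x < 0) {a b : G} {L : List G}
    (h0 : ∀ x ∈ a :: b :: L, x ≠ 0) (hsum : h (a :: b :: L).sum = 0) :
    gapWeight φ (0 < h ·) 0 (a :: b :: L) = 0 := by
  by_contra hw
  rcases lt_or_ge 0 (h a) with ha | ha
  · have := pos_of_gapWeight_ne_zero hpos hw ha (by simpa using ha)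
    rw [zero_add, hsum] at this
    exact this.false
  · have := neg_of_gapWeight_ne_zero hpos hneg (fun x hx => h0 x (List.mem_cons_of_mem _ hx)) hw ha
      (by simpa using ha)
    rw [zero_add, hsum] at this
    exact this.false

end Vanishing

end Weights

section Inversion

variable {N : ℕ} {P A : Type*} [LinearOrder P] [Ring A]

lemma sum_blockWeight_eq_sum_gapWeight (φ : (Fin N → ℕ) → P) (q : (Fin N → ℕ) → Prop)
    {δ κ : (Fin N → ℕ) → A}
    (hκ : ∀ r, r ≠ 0 → κ r = ∑ L ∈ compositions r,
      iverson (L.Pairwise fun a b => φ b < φ a) • (L.map δ).prod) (s r : Fin N → ℕ) :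
    ∑ L ∈ compositions r, blockWeight q s L • (L.map κ).prod =
      ∑ L ∈ compositions r, gapWeight φ q s L • (L.map δ).prod := by
  induction r using WellFoundedLT.induction generalizing s with
  | ind r ih =>
    by_cases hr : r = 0
    · subst hr
      simp [compositions_zero, blockWeight, gapWeight]
    have hsingle : ∑ L ∈ compositions r, (iverson (L.tail = []) • (L.map κ).prod) = κ r := by
      rw [Finset.sum_eq_single_of_mem [r] (singleton_mem_compositions hr)]
      · simp
      · intro L hL hne
        obtain ⟨a, L, rfl⟩ := List.exists_cons_of_ne_nil (ne_nil_of_mem_compositions hr hL)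
        have : L ≠ [] := by
          rintro rfl
          have := (mem_compositions.1 hL).2
          simp only [List.sum_singleton] at this
          exact hne (by rw [this])
        simp [this]
    rw [sum_compositions_eq_sum_cons hr] at hsingle ⊢
    simp only [List.tail_cons, blockWeight, sub_smul, Finset.sum_sub_distrib] at hsingle ⊢
    rw [hsingle, hκ r hr]
    have hgap := fun L hL => congrArg (· • (L.map δ).prod)
      (gapWeight_eq_sub_sum φ q s (ne_nil_of_mem_compositions hr (L := L) hL))
    rw [Finset.sum_congr rfl hgap]
    simp only [sub_smul, Finset.sum_sub_distrib]
    congr 1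
    calc _ = ∑ p ∈ splittings r, ∑ L ∈ compositions p.1, ∑ M ∈ compositions p.2,
          (iverson (L.Pairwise fun a b => φ b < φ a) *
            (iverson (q (s + L.sum)) * gapWeight φ q (s + L.sum) M)) •
              ((L ++ M).map δ).prod := by
          refine Finset.sum_congr rfl ?_
          rintro ⟨a, b⟩ hp
          obtain ⟨rfl, ha⟩ := mem_splittings.1 hp
          have hb := ih b (lt_add_of_pos_left b (pos_iff_ne_zero.2 ha)) (s + a)
          simp only at ha ⊢
          calc _ = iverson (q (s + a)) • (κ a * ∑ M ∈ compositions b,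
                  blockWeight q (s + a) M • (M.map κ).prod) := by
                simp only [Finset.mul_sum, Finset.smul_sum, List.map_cons, List.prod_cons,
                  mul_smul_comm, mul_smul]
            _ = _ := by
                rw [hb, hκ a ha, Finset.sum_mul_sum, Finset.smul_sum]
                refine Finset.sum_congr rfl fun L hL => ?_
                rw [(mem_compositions.1 hL).2, Finset.smul_sum]
                refine Finset.sum_congr rfl fun M _ => ?_
                rw [List.map_append, List.prod_append, smul_mul_smul_comm, smul_smul]
                congr 1
                ring
      _ = _ := by
          rw [sum_compositions_eq_sum_append r fun L M =>
            (iverson (L.Pairwise fun a b => φ b < φ a) *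
              (iverson (q (s + L.sum)) * gapWeight φ q (s + L.sum) M)) • ((L ++ M).map δ).prod]
          simp only [List.take_append_drop, Finset.sum_smul]

end Inversion

lemma arg_lt_arg_iff_of_im_pos {z w : ℂ} (hz : 0 < z.im) (hw : 0 < w.im) :
    z.arg < w.arg ↔ 0 < z.re * w.im - z.im * w.re := by
  have hz0 : z ≠ 0 := by rintro rfl; simp at hz
  have hw0 : w ≠ 0 := by rintro rfl; simp at hw
  have hz' : 0 < ‖z‖ := norm_pos_iff.2 hz0
  have hw' : 0 < ‖w‖ := norm_pos_iff.2 hw0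
  have hsin : Real.sin (w.arg - z.arg) * (‖z‖ * ‖w‖) = z.re * w.im - z.im * w.re := by
    rw [Real.sin_sub, sin_arg, sin_arg, cos_arg hz0, cos_arg hw0]
    field_simp
  have hz1 := arg_nonneg_iff.2 hz.le
  have hw1 := arg_nonneg_iff.2 hw.le
  have hz2 := arg_lt_pi_iff.2 (Or.inr hz.ne')
  have hw2 := arg_lt_pi_iff.2 (Or.inr hw.ne')
  rw [← hsin, mul_pos_iff_of_pos_right (mul_pos hz' hw')]
  constructor
  · exact fun h => Real.sin_pos_of_pos_of_lt_pi (by linarith) (by linarith)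
  · intro h
    by_contra! hle
    exact h.not_ge (Real.sin_nonpos_of_nonpos_of_neg_pi_le (by linarith) (by linarith))

/-- The additive function `v ↦ Im (Z v * conj c)`, the oriented area spanned by `c` and `Z v`. -/
noncomputable def crossHom {N : ℕ} (Z : (Fin N → ℤ) →+ ℂ) (c : ℂ) : (Fin N → ℕ) →+ ℝ where
  toFun v := c.re * (Z fun i => (v i : ℤ)).im - c.im * (Z fun i => (v i : ℤ)).re
  map_zero' := by
    have : (fun i => (((0 : Fin N → ℕ) i : ℕ) : ℤ)) = 0 := by ext; simp
    rw [this]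
    simp
  map_add' v w := by
    have : (fun i => (((v + w) i : ℕ) : ℤ)) = (fun i => (v i : ℤ)) + fun i => (w i : ℤ) := by
      ext; simp
    rw [this, map_add, add_re, add_im]
    ring

section Phase

variable {N : ℕ} {Z : (Fin N → ℤ) →+ ℂ}

lemma latticePhase_lt_iff
    (hZ : ∀ γ : Fin N → ℕ, γ ≠ 0 → 0 < (Z fun i => (γ i : ℤ)).im)
    {v w : Fin N → ℕ} (hv : v ≠ 0) (hw : w ≠ 0) :
    latticePhase Z v < latticePhase Z w ↔ 0 < crossHom Z (Z fun i => (v i : ℤ)) w := by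
  rw [latticePhase, latticePhase, div_lt_div_iff_of_pos_right Real.pi_pos]
  exact arg_lt_arg_iff_of_im_pos (hZ v hv) (hZ w hw)

lemma latticePhase_lt_iff_crossHom_pos
    (hZ : ∀ γ : Fin N → ℕ, γ ≠ 0 → 0 < (Z fun i => (γ i : ℤ)).im)
    {v : Fin N → ℕ} (hv : v ≠ 0) (w : Fin N → ℕ) :
    latticePhase Z v < latticePhase Z w ↔ 0 < crossHom Z (Z fun i => (v i : ℤ)) w := by
  by_cases hw : w = 0
  · subst hw
    have h0 : (fun i => (((0 : Fin N → ℕ) i : ℕ) : ℤ)) = 0 := by ext; simp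
    have : latticePhase Z 0 = 0 := by rw [latticePhase, h0]; simp
    rw [map_zero, this]
    simp only [lt_self_iff_false, iff_false, not_lt]
    exact div_nonneg (arg_nonneg_iff.2 (hZ v hv).le) Real.pi_pos.le
  · exact latticePhase_lt_iff hZ hv hw

lemma crossHom_neg_of_latticePhase_lt
    (hZ : ∀ γ : Fin N → ℕ, γ ≠ 0 → 0 < (Z fun i => (γ i : ℤ)).im)
    {v w : Fin N → ℕ} (hv : v ≠ 0) (hw : w ≠ 0)
    (h : latticePhase Z w < latticePhase Z v) : crossHom Z (Z fun i => (v i : ℤ)) w < 0 := by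
  have := (latticePhase_lt_iff hZ hw hv).1 h
  simp only [crossHom, AddMonoidHom.coe_mk, ZeroHom.coe_mk] at this ⊢
  linarith

end Phase

end ReinekeInversion

open ReinekeInversion

/-- **Reineke's inversion formula**: if
`κ_γ = Σ_{n≥1} Σ_{γ₁+⋯+γₙ=γ, φ(γ₁)>⋯>φ(γₙ)} δ_{γ₁}·…·δ_{γₙ}`
(Harder–Narasimhan recursion), then
`δ_γ = Σ_{n≥1} (−1)^{n−1} Σ_{γ₁+⋯+γₙ=γ, φ(γ₁+⋯+γᵢ)>φ(γ) for 1 ≤ i ≤ n−1}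
κ_{γ₁}·…·κ_{γₙ}`. -/
theorem reineke_inversion {N : ℕ} (hN : 1 ≤ N) (Z : (Fin N → ℤ) →+ ℂ)
    (hZ : ∀ γ : Fin N → ℕ, γ ≠ 0 → 0 < (Z fun i => (γ i : ℤ)).im)
    {A : Type*} [Ring A] [Algebra ℂ A] (δ κ : (Fin N → ℕ) → A)
    (hκ : ∀ γ : Fin N → ℕ, γ ≠ 0 →
      κ γ = ∑ᶠ L ∈ {L : List (Fin N → ℕ) | L ≠ [] ∧ (∀ x ∈ L, x ≠ 0) ∧ L.sum = γ ∧
          L.Pairwise (fun a b => latticePhase Z b < latticePhase Z a)},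
        (L.map δ).prod)
    (γ : Fin N → ℕ) (hγ : γ ≠ 0) :
    δ γ = ∑ᶠ L ∈ {L : List (Fin N → ℕ) | L ≠ [] ∧ (∀ x ∈ L, x ≠ 0) ∧ L.sum = γ ∧
        ∀ i : ℕ, 1 ≤ i → i < L.length →
          latticePhase Z γ < latticePhase Z (L.take i).sum},
      (-1 : A) ^ (L.length - 1) * (L.map κ).prod := by
  set h := crossHom Z (Z fun i => (γ i : ℤ)) with hdef
  have hpos := latticePhase_lt_iff_crossHom_pos hZ hγ
  rw [← hdef] at hpos
  have hκ' : ∀ r, r ≠ 0 → κ r = ∑ L ∈ compositions r,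
      iverson (L.Pairwise fun a b => latticePhase Z b < latticePhase Z a) • (L.map δ).prod := by
    intro r hr
    rw [hκ r hr, finsum_eq_sum_compositions hr
      (fun L => L.Pairwise fun a b => latticePhase Z b < latticePhase Z a)]
  have hsum := sum_blockWeight_eq_sum_gapWeight (latticePhase Z) (0 < h ·) hκ' 0 γ
  rw [Finset.sum_eq_single_of_mem (s := compositions γ)
    (f := fun L => gapWeight _ _ _ L • (L.map δ).prod) [γ] (singleton_mem_compositions hγ)] at hsum
  · rw [finsum_eq_sum_compositions hγ (fun L => ∀ i : ℕ, 1 ≤ i → i < L.length →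
      latticePhase Z γ < latticePhase Z (L.take i).sum)]
    simp only [gapWeight, List.map_singleton, List.prod_singleton, one_smul] at hsum
    rw [← hsum]
    refine Finset.sum_congr rfl fun L hL => ?_
    rw [blockWeight_eq _ _ (ne_nil_of_mem_compositions hγ hL)]
    simp only [hpos, zero_add, mul_smul, zsmul_eq_mul, Int.cast_pow, Int.cast_neg, Int.cast_one]
  · rintro (_ | ⟨a, _ | ⟨b, L⟩⟩) hL hne
    · simp [gapWeight]
    · have := (mem_compositions.1 hL).2
      simp only [List.sum_singleton] at this
      exact absurd (by rw [this]) hne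
    · obtain ⟨h0, hs⟩ := mem_compositions.1 hL
      rw [gapWeight_eq_zero hpos (fun x => crossHom_neg_of_latticePhase_lt hZ hγ) h0, zero_smul]
      rw [hs, hdef]
      simp only [crossHom, AddMonoidHom.coe_mk, ZeroHom.coe_mk]
      ring
end

section
/- Existence and uniqueness of canonical fundamental solutions (case G = GLₙ(ℂ)): let r be an admissible ray. Then there exists a unique holomorphic map Y : H_r → GLₙ(ℂ) such that for all t ∈ H_r the derivative satisfies Y′(t) = (Z/t² + f/t)·Y(t), and Y(t)·exp(Z/t) tends to the identity matrix as t → 0 within H_r. -/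
open Complex Filter Topology

/-- The ray `ℝ_{>0}·c` through a point `c ∈ ℂ`. -/
def rayThrough (c : ℂ) : Set ℂ := {z : ℂ | ∃ t : ℝ, 0 < t ∧ z = t * c}

/-- A ray: a subset of `ℂ∖{0}` of the form `ℝ_{>0}·e^{iπφ}`. -/
def IsRay (r : Set ℂ) : Prop := ∃ c : ℂ, c ≠ 0 ∧ r = rayThrough c

/-- The Stokes rays of the connection determined by `Z = diag(z₁,…,zₙ)` are the
rays `ℝ_{>0}·(z_i − z_j)` for `i ≠ j`. -/
def IsStokesRay {n : ℕ} (z : Fin n → ℂ) (ℓ : Set ℂ) : Prop :=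
  ∃ i j : Fin n, i ≠ j ∧ ℓ = rayThrough (z i - z j)

/-- A ray is admissible if it is not a Stokes ray. -/
def IsAdmissibleRay {n : ℕ} (z : Fin n → ℂ) (r : Set ℂ) : Prop :=
  IsRay r ∧ ¬ IsStokesRay z r

/-- The half-plane `H_r = {u·v : u ∈ r, Re v > 0}` determined by a ray `r`. -/
def halfPlane (r : Set ℂ) : Set ℂ :=
  {z : ℂ | ∃ u ∈ r, ∃ v : ℂ, 0 < v.re ∧ z = u * v}

/-- The closed convex sector `Σ̄(r,r′)` bounded by the rays `r` and `r′`. -/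
def sector (r r' : Set ℂ) : Set ℂ :=
  {z : ℂ | ∃ u ∈ r, ∃ u' ∈ r', ∃ a b : ℝ,
    0 ≤ a ∧ 0 ≤ b ∧ ¬(a = 0 ∧ b = 0) ∧ z = a * u + b * u'}

/-- The matrix `exp(Z/t)` for `Z = diag(z₁,…,zₙ)`: the diagonal matrix with
entries `exp(zᵢ/t)`. -/
noncomputable def expZt {n : ℕ} (z : Fin n → ℂ) (t : ℂ) : Matrix (Fin n) (Fin n) ℂ :=
  Matrix.diagonal fun i => Complex.exp (z i / t)

/-- `Y` is the canonical fundamental solution of `Y′ = (Z/t² + f/t)·Y` on the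
half-plane `H_r`: it is holomorphic and `GLₙ`-valued there, solves the ODE, and
`Y(t)·exp(Z/t) → 1` as `t → 0` in `H_r`. -/
def IsCanonicalSolution {n : ℕ} (z : Fin n → ℂ) (f : Matrix (Fin n) (Fin n) ℂ)
    (r : Set ℂ) (Y : ℂ → Matrix (Fin n) (Fin n) ℂ) : Prop :=
  (∀ t ∈ halfPlane r, IsUnit (Y t)) ∧
  (∀ t ∈ halfPlane r, ∀ i j : Fin n,
    HasDerivAt (fun s => Y s i j)
      ((((t ^ 2)⁻¹ • Matrix.diagonal z + t⁻¹ • f) * Y t) i j) t) ∧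
  (∀ i j : Fin n,
    Tendsto (fun t => (Y t * expZt z t) i j) (𝓝[halfPlane r] 0)
      (𝓝 (if i = j then (1 : ℂ) else 0)))

section
open MeasureTheory Set

/-- A weight on `ℂ` comparable to the norm on the right half-plane, and increasing along
the directions in which the integral equations are solved. -/
def coneWeight (K : ℝ) (s : ℂ) : ℝ := |s.im| + K * s.re

theorem coneWeight_pos {K : ℝ} (hK : 0 < K) {s : ℂ} (hs : 0 < s.re) : 0 < coneWeight K s := by
  unfold coneWeight; positivity

theorem coneWeight_le {K : ℝ} (hK : 0 ≤ K) (s : ℂ) : coneWeight K s ≤ (1 + K) * ‖s‖ := by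
  unfold coneWeight
  nlinarith [abs_im_le_norm s, re_le_norm s]

theorem norm_le_coneWeight {K : ℝ} (hK : 1 ≤ K) {s : ℂ} (hs : 0 < s.re) :
    ‖s‖ ≤ coneWeight K s := by
  unfold coneWeight
  have := norm_le_abs_re_add_abs_im s
  rw [abs_of_pos hs] at this
  nlinarith

theorem continuous_coneWeight (K : ℝ) : Continuous (coneWeight K) := by
  unfold coneWeight; fun_prop

theorem isOpen_rightHalfPlane : IsOpen {s : ℂ | 0 < s.re} :=
  isOpen_lt continuous_const continuous_re

/-- The damped majorant `ρ ↦ e^{-cρ} (c Ω - Ω')(M + ρ)` is integrable, being the derivative of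
`-e^{-cρ} Ω(M + ρ)`. -/
theorem integrable_damped_majorant {c l M : ℝ} {Ω Ω' : ℝ → ℝ} (hM : 0 < M)
    (hΩ : ∀ M > 0, HasDerivAt Ω (Ω' M) M) (hpos : ∀ M > 0, 0 ≤ c * Ω M - Ω' M)
    (hl : Tendsto (fun ρ => Real.exp (-c * ρ) * Ω (M + ρ)) atTop (𝓝 l)) :
    IntegrableOn (fun ρ => Real.exp (-c * ρ) * (c * Ω (M + ρ) - Ω' (M + ρ))) (Ioi 0) ∧
    ∫ ρ in Ioi 0, Real.exp (-c * ρ) * (c * Ω (M + ρ) - Ω' (M + ρ)) = Ω M - l := by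
  have hder : ∀ ρ ∈ Ici (0 : ℝ), HasDerivAt (fun ρ => -(Real.exp (-c * ρ) * Ω (M + ρ)))
      (Real.exp (-c * ρ) * (c * Ω (M + ρ) - Ω' (M + ρ))) ρ := by
    intro ρ hρ
    have hρ' : 0 < M + ρ := add_pos_of_pos_of_nonneg hM hρ
    have h1 : HasDerivAt (fun ρ : ℝ => Real.exp (-c * ρ)) (Real.exp (-c * ρ) * (-c)) ρ := by
      simpa using ((hasDerivAt_id ρ).const_mul (-c)).exp
    have h2 : HasDerivAt (fun ρ : ℝ => Ω (M + ρ)) (Ω' (M + ρ)) ρ := by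
      simpa using (hΩ _ hρ').comp_const_add M ρ
    exact (h1.mul h2).neg.congr_deriv (by ring)
  have hnn : ∀ ρ ∈ Ioi (0 : ℝ), 0 ≤ Real.exp (-c * ρ) * (c * Ω (M + ρ) - Ω' (M + ρ)) :=
    fun ρ hρ => mul_nonneg (Real.exp_pos _).le (hpos _ (add_pos hM hρ))
  refine ⟨integrableOn_Ioi_deriv_of_nonneg' hder hnn hl.neg, ?_⟩
  rw [integral_Ioi_of_hasDerivAt_of_nonneg' hder hnn hl.neg]
  simp
  ring

/-- Solving `y' = -λ y - g` on the right half-plane by integrating along the rays `s + ρ d`. -/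
theorem exists_solution_along_rays {K c l : ℝ} {lam d : ℂ} {g : ℂ → ℂ} {G Ω Ω' : ℝ → ℝ}
    (hK : 0 < K) (hc : 0 ≤ c) (hd : 0 ≤ d.re)
    (hN : ∀ (s : ℂ) (ρ : ℝ), 0 ≤ ρ → coneWeight K s + ρ ≤ coneWeight K (s + ρ * d))
    (hlam : (lam * d).re ≤ -c) (hg : DifferentiableOn ℂ g {s | 0 < s.re})
    (hgG : ∀ s : ℂ, 0 < s.re → ‖g s‖ ≤ G (coneWeight K s))
    (hG : AntitoneOn G (Ioi 0)) (hGpos : ∀ M > 0, 0 ≤ G M) (hG0 : Tendsto G atTop (𝓝 0))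
    (hΩ : ∀ M > 0, HasDerivAt Ω (Ω' M) M) (hGΩ : ∀ M > 0, G M ≤ c * Ω M - Ω' M)
    (hl : ∀ M > 0, Tendsto (fun ρ => Real.exp (-c * ρ) * Ω (M + ρ)) atTop (𝓝 l)) :
    ∃ y : ℂ → ℂ, ∀ s : ℂ, 0 < s.re →
      HasDerivAt y (-lam * y s - g s) s ∧ ‖y s‖ ≤ ‖d‖ * (Ω (coneWeight K s) - l) := by
  set D : ℝ → ℝ → ℝ := fun M ρ => Real.exp (-c * ρ) * (c * Ω (M + ρ) - Ω' (M + ρ)) with hD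
  have hDint : ∀ M > 0, IntegrableOn (D M) (Ioi 0) ∧ ∫ ρ in Ioi 0, D M ρ = Ω M - l :=
    fun M hM => integrable_damped_majorant hM hΩ
      (fun M hM => (hGpos M hM).trans (hGΩ M hM)) (hl M hM)
  have hmem : ∀ {s : ℂ} {ρ : ℝ}, 0 < s.re → 0 ≤ ρ → 0 < (s + ρ * d).re := by
    intro s ρ hs hρ
    have : 0 ≤ ρ * d.re := mul_nonneg hρ hd
    simp; linarith
  have hexp : ∀ ρ : ℝ, 0 ≤ ρ → ‖exp (lam * d * ρ)‖ ≤ Real.exp (-c * ρ) := by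
    intro ρ hρ
    rw [norm_exp]
    apply Real.exp_le_exp.2
    have : (lam * d * ρ).re = (lam * d).re * ρ := by simp
    rw [this]
    exact mul_le_mul_of_nonneg_right hlam hρ
  have hgM : ∀ {M : ℝ} {s : ℂ} {ρ : ℝ}, 0 < M → 0 < s.re → 0 ≤ ρ → M ≤ coneWeight K s →
      ‖g (s + ρ * d)‖ ≤ G (M + ρ) := by
    intro M s ρ hM hs hρ hMs
    refine (hgG _ (hmem hs hρ)).trans (hG (add_pos_of_pos_of_nonneg hM hρ)
      (coneWeight_pos hK (hmem hs hρ)) ?_)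
    linarith [hN s ρ hρ]
  have hgD : ∀ {M ρ : ℝ}, 0 < M → 0 ≤ ρ → Real.exp (-c * ρ) * G (M + ρ) ≤ D M ρ := by
    intro M ρ hM hρ
    exact mul_le_mul_of_nonneg_left (hGΩ _ (add_pos_of_pos_of_nonneg hM hρ)) (Real.exp_pos _).le
  set F : ℂ → ℝ → ℂ := fun s ρ => exp (lam * d * ρ) * g (s + ρ * d) with hF
  set F' : ℂ → ℝ → ℂ := fun s ρ => exp (lam * d * ρ) * deriv g (s + ρ * d) with hF'
  have hopen := isOpen_rightHalfPlane
  have hcont : ∀ {h : ℂ → ℂ}, ContinuousOn h {s | 0 < s.re} → ∀ {s : ℂ}, 0 < s.re →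
      AEStronglyMeasurable (fun ρ : ℝ => exp (lam * d * ρ) * h (s + ρ * d))
        (volume.restrict (Ioi 0)) := by
    intro h hh s hs
    refine ContinuousOn.aestronglyMeasurable ?_ measurableSet_Ioi
    refine ContinuousOn.mul (by fun_prop) (hh.comp (by fun_prop) ?_)
    exact fun ρ hρ => hmem hs (le_of_lt hρ)
  have hFD : ∀ {M : ℝ} {s : ℂ} {ρ : ℝ}, 0 < M → 0 < s.re → 0 ≤ ρ → M ≤ coneWeight K s →
      ‖F s ρ‖ ≤ Real.exp (-c * ρ) * G (M + ρ) := by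
    intro M s ρ hM hs hρ hMs
    rw [hF, norm_mul]
    exact mul_le_mul (hexp ρ hρ) (hgM hM hs hρ hMs) (norm_nonneg _) (Real.exp_pos _).le
  have hFint : ∀ {s : ℂ}, 0 < s.re → IntegrableOn (F s) (Ioi 0) := by
    intro s hs
    have hM := coneWeight_pos hK hs
    refine (hDint _ hM).1.mono' (hcont hg.continuousOn hs) ?_
    filter_upwards [ae_restrict_mem measurableSet_Ioi] with ρ hρ
    exact (hFD hM hs (le_of_lt hρ) le_rfl).trans (hgD hM (le_of_lt hρ))
  refine ⟨fun s => d * ∫ ρ in Ioi (0 : ℝ), F s ρ, fun s hs => ⟨?_, ?_⟩⟩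
  · have hM0 := coneWeight_pos hK hs
    set M := coneWeight K s / 2 with hMdef
    have hM : 0 < M := by positivity
    obtain ⟨ε, hε, hball⟩ := Metric.isOpen_iff.1
      (hopen.inter (isOpen_lt continuous_const (continuous_coneWeight K)) :
        IsOpen ({s : ℂ | 0 < s.re} ∩ {s | M < coneWeight K s})) s ⟨hs, half_lt_self hM0⟩
    have key : Integrable (F' s) (volume.restrict (Ioi 0)) ∧
        HasDerivAt (fun s => ∫ ρ in Ioi (0 : ℝ), F s ρ) (∫ ρ in Ioi (0 : ℝ), F' s ρ) s := by
      refine hasDerivAt_integral_of_dominated_loc_of_deriv_le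
        (bound := fun ρ => D M ρ / (ε / 4)) (Metric.ball_mem_nhds s (half_pos hε))
        ?_ (hFint hs) (hcont (hg.deriv hopen).continuousOn hs) ?_ ((hDint M hM).1.div_const _) ?_
      · filter_upwards [hopen.mem_nhds hs] with w hw
        exact hcont hg.continuousOn hw
      · filter_upwards [ae_restrict_mem measurableSet_Ioi] with ρ hρ w hw
        have hρ0 : 0 ≤ ρ := le_of_lt hρ
        have hsub : ∀ v ∈ Metric.closedBall (w + ρ * d) (ε / 4),
            0 < v.re ∧ ‖g v‖ ≤ G (M + ρ) := by
          intro v hv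
          have hv' : v - ρ * d ∈ Metric.ball s ε := by
            rw [Metric.mem_ball, dist_eq_norm] at hw ⊢
            rw [Metric.mem_closedBall, dist_eq_norm] at hv
            calc ‖v - ρ * d - s‖ = ‖(v - (w + ρ * d)) + (w - s)‖ := by ring_nf
              _ ≤ _ := norm_add_le _ _
              _ < ε := by linarith
          obtain ⟨h1, h2⟩ := hball hv'
          have h3 := hmem h1 hρ0
          have h4 := hgM hM h1 hρ0 (le_of_lt h2)
          rw [sub_add_cancel] at h3 h4
          exact ⟨h3, h4⟩
        have hder : ‖deriv g (w + ρ * d)‖ ≤ G (M + ρ) / (ε / 4) := by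
          refine norm_deriv_le_of_forall_mem_sphere_norm_le (by positivity) ?_
            fun v hv => (hsub v (Metric.sphere_subset_closedBall hv)).2
          refine DifferentiableOn.diffContOnCl ?_
          rw [closure_ball _ (by positivity)]
          exact hg.mono fun v hv => (hsub v hv).1
        rw [hF', norm_mul]
        calc _ ≤ Real.exp (-c * ρ) * (G (M + ρ) / (ε / 4)) :=
              mul_le_mul (hexp ρ hρ0) hder (norm_nonneg _) (Real.exp_pos _).le
          _ = Real.exp (-c * ρ) * G (M + ρ) / (ε / 4) := by ring
          _ ≤ _ := by
            have := hgD hM hρ0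
            gcongr
      · filter_upwards [ae_restrict_mem measurableSet_Ioi] with ρ hρ w hw
        have hw' : 0 < w.re := (hball (Metric.ball_subset_ball (by linarith) hw)).1
        have h := (hg.differentiableAt (hopen.mem_nhds (hmem hw' (le_of_lt hρ)))).hasDerivAt
        exact (h.comp_add_const w (ρ * d)).const_mul _
    have hftc : ∫ ρ in Ioi (0 : ℝ), (lam * d * F s ρ + d * F' s ρ) = 0 - F s 0 := by
      refine integral_Ioi_of_hasDerivAt_of_tendsto' ?_
        (((hFint hs).const_mul _).add (key.1.const_mul _)) ?_
      · intro ρ hρ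
        have h := (hg.differentiableAt (hopen.mem_nhds (hmem hs hρ))).hasDerivAt
        have h1 : HasDerivAt (fun ρ : ℝ => s + ρ * d) d ρ := by
          simpa using ((Complex.ofRealCLM.hasDerivAt (x := ρ)).mul_const d).const_add s
        have h2 : HasDerivAt (fun ρ : ℝ => lam * d * ρ) (lam * d) ρ := by
          simpa using (Complex.ofRealCLM.hasDerivAt (x := ρ)).const_mul (lam * d)
        refine (h2.cexp.mul (h.scomp ρ h1)).congr_deriv ?_
        simp only [hF, hF', Function.comp_apply, smul_eq_mul]
        ring
      · have hlim : Tendsto (fun ρ => G (coneWeight K s + ρ)) atTop (𝓝 0) :=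
          hG0.comp (tendsto_atTop_add_const_left _ _ tendsto_id)
        refine squeeze_zero_norm' ?_ hlim
        filter_upwards [eventually_ge_atTop 0] with ρ hρ
        refine (hFD hM0 hs hρ le_rfl).trans ?_
        refine mul_le_of_le_one_left (hGpos _ (by positivity)) ?_
        rw [Real.exp_le_one_iff]
        nlinarith
    rw [integral_add ((hFint hs).const_mul _) (key.1.const_mul _), integral_const_mul,
      integral_const_mul] at hftc
    refine (key.2.const_mul d).congr_deriv ?_
    have hF0 : F s 0 = g s := by simp [hF]
    rw [hF0] at hftc
    linear_combination hftc
  · have hM := coneWeight_pos hK hs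
    rw [norm_mul, ← (hDint _ hM).2]
    refine mul_le_mul_of_nonneg_left (norm_integral_le_of_norm_le (hDint _ hM).1 ?_)
      (norm_nonneg _)
    filter_upwards [ae_restrict_mem measurableSet_Ioi] with ρ hρ
    exact (hFD hM hs (le_of_lt hρ) le_rfl).trans (hgD hM (le_of_lt hρ))

/-- The weight controlling the dominant component of a column solution. -/
noncomputable def dominantWeight (Q M : ℝ) : ℝ := Real.exp (2 * Q ^ 2 / M)

/-- The weight controlling the other components of a column solution. -/
noncomputable def recessiveWeight (Q M : ℝ) : ℝ := 2 * Q / M * Real.exp (2 * Q ^ 2 / M)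

theorem dominantWeight_pos (Q M : ℝ) : 0 < dominantWeight Q M := Real.exp_pos _

theorem recessiveWeight_pos {Q M : ℝ} (hQ : 0 < Q) (hM : 0 < M) : 0 < recessiveWeight Q M := by
  unfold recessiveWeight; positivity

theorem antitoneOn_dominantWeight (Q : ℝ) : AntitoneOn (dominantWeight Q) (Ioi 0) := by
  intro a ha b hb hab
  have ha : 0 < a := ha
  unfold dominantWeight
  gcongr

theorem antitoneOn_recessiveWeight {Q : ℝ} (hQ : 0 < Q) :
    AntitoneOn (recessiveWeight Q) (Ioi 0) := by
  intro a ha b hb hab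
  have ha : 0 < a := ha
  have hb : 0 < b := hb
  unfold recessiveWeight
  gcongr

theorem tendsto_dominantWeight (Q : ℝ) : Tendsto (dominantWeight Q) atTop (𝓝 1) := by
  have h : Tendsto (fun M : ℝ => 2 * Q ^ 2 / M) atTop (𝓝 0) :=
    tendsto_const_nhds.div_atTop tendsto_id
  have h' := (Real.continuous_exp.tendsto 0).comp h
  rwa [Real.exp_zero] at h'

theorem tendsto_recessiveWeight (Q : ℝ) : Tendsto (recessiveWeight Q) atTop (𝓝 0) := by
  have h : Tendsto (fun M : ℝ => 2 * Q / M) atTop (𝓝 0) :=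
    tendsto_const_nhds.div_atTop tendsto_id
  have h' := h.mul (tendsto_dominantWeight Q)
  rwa [zero_mul] at h'

theorem hasDerivAt_dominantWeight (Q : ℝ) {M : ℝ} (hM : 0 < M) :
    HasDerivAt (dominantWeight Q) (-(2 * Q ^ 2 / M ^ 2) * dominantWeight Q M) M := by
  have h : HasDerivAt (fun M : ℝ => 2 * Q ^ 2 / M) (-(2 * Q ^ 2 / M ^ 2)) M := by
    refine ((hasDerivAt_inv hM.ne').const_mul (2 * Q ^ 2)).congr_deriv ?_
    field_simp
  exact h.exp.congr_deriv (mul_comm _ _)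

theorem hasDerivAt_recessiveWeight (Q : ℝ) {M : ℝ} (hM : 0 < M) :
    HasDerivAt (recessiveWeight Q)
      (-(2 * Q / M ^ 2 + 4 * Q ^ 3 / M ^ 3) * dominantWeight Q M) M := by
  have h : HasDerivAt (fun M : ℝ => 2 * Q / M) (-(2 * Q / M ^ 2)) M := by
    refine ((hasDerivAt_inv hM.ne').const_mul (2 * Q)).congr_deriv ?_
    field_simp
  refine (h.mul (hasDerivAt_dominantWeight Q hM)).congr_deriv ?_
  field_simp
  ring

theorem dominantWeight_supersolution (Q : ℝ) {M : ℝ} (hM : 0 < M) :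
    Q / M * recessiveWeight Q M ≤ 2 * Q ^ 2 / M ^ 2 * dominantWeight Q M := by
  apply le_of_eq
  unfold recessiveWeight dominantWeight
  field_simp

theorem recessiveWeight_supersolution {Q M : ℝ} (hQ : 0 < Q) (hM : 0 < M) :
    Q / M * (dominantWeight Q M + recessiveWeight Q M) ≤
      recessiveWeight Q M + (2 * Q / M ^ 2 + 4 * Q ^ 3 / M ^ 3) * dominantWeight Q M := by
  have hpoly : Q / M * (1 + 2 * Q / M) ≤ 2 * Q / M + (2 * Q / M ^ 2 + 4 * Q ^ 3 / M ^ 3) := by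
    rw [← sub_nonneg]
    have : 2 * Q / M + (2 * Q / M ^ 2 + 4 * Q ^ 3 / M ^ 3) - Q / M * (1 + 2 * Q / M) =
        Q * ((M - Q) ^ 2 + 2 * M + 3 * Q ^ 2) / M ^ 3 := by
      field_simp
      ring
    rw [this]
    positivity
  have h := mul_le_mul_of_nonneg_right hpoly (dominantWeight_pos Q M).le
  have hrec : recessiveWeight Q M = 2 * Q / M * dominantWeight Q M := rfl
  rw [hrec]
  linarith

/-- The weight controlling the `i`-th component of the `j`-th column. -/
noncomputable def columnWeight {n : ℕ} (Q : ℝ) (j i : Fin n) : ℝ → ℝ :=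
  if i = j then dominantWeight Q else recessiveWeight Q

theorem columnWeight_pos {n : ℕ} {Q M : ℝ} (hQ : 0 < Q) (hM : 0 < M) (j i : Fin n) :
    0 < columnWeight Q j i M := by
  unfold columnWeight
  split_ifs
  exacts [dominantWeight_pos Q M, recessiveWeight_pos hQ hM]

theorem antitoneOn_columnWeight {n : ℕ} {Q : ℝ} (hQ : 0 < Q) (j i : Fin n) :
    AntitoneOn (columnWeight Q j i) (Ioi 0) := by
  unfold columnWeight
  split_ifs
  exacts [antitoneOn_dominantWeight Q, antitoneOn_recessiveWeight hQ]

theorem tendsto_columnWeight {n : ℕ} (Q : ℝ) (j i : Fin n) :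
    Tendsto (columnWeight Q j i) atTop (𝓝 (if i = j then 1 else 0)) := by
  unfold columnWeight
  split_ifs
  exacts [tendsto_dominantWeight Q, tendsto_recessiveWeight Q]

/-- If `lam` is not real, some direction in the open cone `|Im| < K Re` makes
`ρ ↦ exp (lam d ρ)` decay. -/
theorem exists_decay_direction {T : ℝ} (hT : 0 ≤ T) {lam : ℂ}
    (h : lam.re + 1 ≤ |lam.im| * T) :
    ∃ d : ℂ, 0 ≤ d.re ∧ ‖d‖ ≤ T + 1 ∧ (lam * d).re ≤ -1 ∧
      ∀ (s : ℂ) (ρ : ℝ), 0 ≤ ρ → coneWeight (T + 1) s + ρ ≤ coneWeight (T + 1) (s + ρ * d) := by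
  obtain ⟨σ, hσ, hσ'⟩ : ∃ σ : ℝ, |σ| = 1 ∧ lam.im * σ = |lam.im| := by
    rcases le_total 0 lam.im with h0 | h0
    · exact ⟨1, by simp, by simp [abs_of_nonneg h0]⟩
    · exact ⟨-1, by simp, by simp [abs_of_nonpos h0]⟩
  refine ⟨⟨1, σ * T⟩, by simp, ?_, ?_, fun s ρ hρ => ?_⟩
  · refine (norm_le_abs_re_add_abs_im _).trans ?_
    simp only [abs_one, abs_mul, hσ, abs_of_nonneg hT]
    linarith
  · simp only [mul_re, mul_one, ← mul_assoc, hσ']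
    linarith
  · have hab : |s.im| ≤ |s.im + ρ * (σ * T)| + ρ * T := by
      have h1 := abs_sub (s.im + ρ * (σ * T)) (ρ * (σ * T))
      rwa [add_sub_cancel_right, abs_mul ρ, abs_mul σ, hσ, one_mul, abs_of_nonneg hρ,
        abs_of_nonneg hT] at h1
    simp only [coneWeight, add_im, mul_im, ofReal_re, ofReal_im, zero_mul, add_zero, add_re,
      mul_re, sub_zero, mul_one]
    linarith

/-- One step of the Picard iteration for the `i`-th component of the `j`-th column. -/
theorem exists_picard_component {n : ℕ} {T S Q a : ℝ} (hT : 0 ≤ T) (hS : 0 < S)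
    (hQ : Q = 2 * (T + 1) * ((T + 2) * S)) (ha : 0 < a) {lam : ℂ} {A : Fin n → ℂ} {i j : Fin n}
    (hAS : ∑ k, ‖A k‖ ≤ S) (hlam : i = j → lam = 0) (hAj : i = j → A j = 0)
    (hlamT : i ≠ j → lam.re + 1 ≤ |lam.im| * T) {x : Fin n → ℂ → ℂ}
    (hx : ∀ k, DifferentiableOn ℂ (x k) {s | 0 < s.re})
    (hxw : ∀ k, ∀ s : ℂ, 0 < s.re → ‖x k s‖ ≤ a * columnWeight Q j k (coneWeight (T + 1) s)) :
    ∃ y : ℂ → ℂ, ∀ s : ℂ, 0 < s.re →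
      HasDerivAt y (-lam * y s - s⁻¹ * ∑ k, A k * x k s) s ∧
      ‖y s‖ ≤ a / 2 * (columnWeight Q j i (coneWeight (T + 1) s) - if i = j then 1 else 0) := by
  have hK : 0 < T + 1 := by linarith
  have hQ0 : 0 < Q := by rw [hQ]; positivity
  set κ := a / (2 * (T + 1)) with hκ
  have hκ0 : 0 < κ := by positivity
  have hg : DifferentiableOn ℂ (fun s => s⁻¹ * ∑ k, A k * x k s) {s | 0 < s.re} := by
    refine DifferentiableOn.mul (differentiableOn_inv.mono fun s hs h => ?_)
      (DifferentiableOn.fun_sum fun k _ => (hx k).const_mul _)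
    simp [h] at hs
  have hbound : ∀ {b : ℝ} {s : ℂ}, 0 < s.re → 0 ≤ b →
      (∀ k, A k ≠ 0 → ‖x k s‖ ≤ a * b) →
      ‖s⁻¹ * ∑ k, A k * x k s‖ ≤ κ * (Q / coneWeight (T + 1) s * b) := by
    intro b s hs hb hb'
    have hM := coneWeight_pos hK hs
    have hs0 : 0 < ‖s‖ := norm_pos_iff.2 fun h => by simp [h] at hs
    have h1 : ‖∑ k, A k * x k s‖ ≤ S * (a * b) := by
      refine (norm_sum_le _ _).trans ?_
      calc ∑ k, ‖A k * x k s‖ ≤ ∑ k, ‖A k‖ * (a * b) := by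
            refine Finset.sum_le_sum fun k _ => ?_
            rw [norm_mul]
            by_cases hk : A k = 0
            · simp [hk]
            · exact mul_le_mul_of_nonneg_left (hb' k hk) (norm_nonneg _)
        _ = (∑ k, ‖A k‖) * (a * b) := (Finset.sum_mul _ _ _).symm
        _ ≤ _ := mul_le_mul_of_nonneg_right hAS (by positivity)
    have h2 : ‖s‖⁻¹ ≤ (T + 2) / coneWeight (T + 1) s := by
      rw [inv_eq_one_div, div_le_div_iff₀ hs0 hM]
      linarith [coneWeight_le hK.le s]
    rw [norm_mul, norm_inv]
    calc _ ≤ (T + 2) / coneWeight (T + 1) s * (S * (a * b)) :=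
          mul_le_mul h2 h1 (norm_nonneg _) (by positivity)
      _ = _ := by
        rw [hκ, hQ]
        field_simp
  have hinv : Tendsto (fun M : ℝ => Q / M) atTop (𝓝 0) :=
    tendsto_const_nhds.div_atTop tendsto_id
  have hanti : ∀ {w : ℝ → ℝ}, AntitoneOn w (Ioi 0) → (∀ M > 0, 0 ≤ w M) →
      AntitoneOn (fun M => κ * (Q / M * w M)) (Ioi 0) := by
    intro w hw hw0 b hb c hc hbc
    have hb' : 0 < b := hb
    have h1 := hw hb hc hbc
    have h2 := hw0 c hc
    dsimp only
    gcongr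
  have hshift : ∀ M : ℝ, Tendsto (fun ρ : ℝ => M + ρ) atTop atTop := fun M =>
    tendsto_atTop_add_const_left _ _ tendsto_id
  have hscale : ∀ {d : ℂ} {u : ℝ}, ‖d‖ ≤ T + 1 → 0 ≤ κ * u → ‖d‖ * (κ * u) ≤ a / 2 * u := by
    intro d u hd hu
    refine (mul_le_mul_of_nonneg_right hd hu).trans (le_of_eq ?_)
    rw [hκ]
    field_simp
  by_cases hij : i = j
  · have hw : ∀ k, A k ≠ 0 → columnWeight Q j k = recessiveWeight Q := by
      intro k hk
      have : k ≠ j := fun h => hk (h ▸ hAj hij)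
      simp [columnWeight, this]
    obtain ⟨y, hy⟩ := exists_solution_along_rays (K := T + 1) (c := 0) (l := κ * 1) (lam := lam)
      (d := 1) (G := fun M => κ * (Q / M * recessiveWeight Q M))
      (Ω := fun M => κ * dominantWeight Q M)
      (Ω' := fun M => κ * (-(2 * Q ^ 2 / M ^ 2) * dominantWeight Q M)) hK le_rfl (by simp)
      (fun s ρ hρ => by
        simp only [coneWeight, mul_one, add_im, ofReal_im, add_zero, add_re, ofReal_re]
        nlinarith)
      (by simp [hlam hij]) hg
      (fun s hs => hbound hs (recessiveWeight_pos hQ0 (coneWeight_pos hK hs)).le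
        fun k hk => hw k hk ▸ hxw k s hs)
      (hanti (antitoneOn_recessiveWeight hQ0) fun M hM => (recessiveWeight_pos hQ0 hM).le)
      (fun M hM => by have := recessiveWeight_pos hQ0 hM; positivity)
      (by simpa using (hinv.mul (tendsto_recessiveWeight Q)).const_mul κ)
      (fun M hM => (hasDerivAt_dominantWeight Q hM).const_mul κ)
      (fun M hM => by
        have := mul_le_mul_of_nonneg_left (dominantWeight_supersolution Q hM) hκ0.le
        linarith)
      (fun M _ => by
        simpa using ((tendsto_dominantWeight Q).comp (hshift M)).const_mul κ)
    refine ⟨y, fun s hs => ⟨(hy s hs).1, (hy s hs).2.trans ?_⟩⟩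
    rw [← mul_sub]
    simp only [columnWeight, hij, if_true]
    refine hscale (by simpa using hT) (mul_nonneg hκ0.le ?_)
    rw [sub_nonneg]
    have := coneWeight_pos hK hs
    exact Real.one_le_exp (by positivity)
  · obtain ⟨d, hd, hdT, hdlam, hN⟩ := exists_decay_direction hT (hlamT hij)
    have hw : ∀ {k M}, 0 < M →
        columnWeight Q j k M ≤ dominantWeight Q M + recessiveWeight Q M := by
      intro k M hM
      have h1 := dominantWeight_pos Q M
      have h2 := recessiveWeight_pos hQ0 hM
      unfold columnWeight
      split_ifs <;> linarith
    have hpos : ∀ {M}, 0 < M → 0 < dominantWeight Q M + recessiveWeight Q M := fun hM =>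
      add_pos (dominantWeight_pos Q _) (recessiveWeight_pos hQ0 hM)
    obtain ⟨y, hy⟩ := exists_solution_along_rays (K := T + 1) (c := 1) (l := κ * 0) (lam := lam)
      (d := d) (G := fun M => κ * (Q / M * (dominantWeight Q M + recessiveWeight Q M)))
      (Ω := fun M => κ * recessiveWeight Q M)
      (Ω' := fun M => κ * (-(2 * Q / M ^ 2 + 4 * Q ^ 3 / M ^ 3) * dominantWeight Q M))
      hK zero_le_one hd hN hdlam hg
      (fun s hs => hbound hs (hpos (coneWeight_pos hK hs)).le fun k _ =>
        (hxw k s hs).trans (mul_le_mul_of_nonneg_left (hw (coneWeight_pos hK hs)) ha.le))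
      (hanti ((antitoneOn_dominantWeight Q).add (antitoneOn_recessiveWeight hQ0))
        fun M hM => (hpos hM).le)
      (fun M hM => by have := hpos hM; positivity)
      (by simpa using
        (hinv.mul ((tendsto_dominantWeight Q).add (tendsto_recessiveWeight Q))).const_mul κ)
      (fun M hM => (hasDerivAt_recessiveWeight Q hM).const_mul κ)
      (fun M hM => by
        have := mul_le_mul_of_nonneg_left (recessiveWeight_supersolution hQ0 hM) hκ0.le
        linarith)
      (fun M _ => by
        have h1 : Tendsto (fun ρ : ℝ => Real.exp (-1 * ρ)) atTop (𝓝 0) := by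
          simpa using Real.tendsto_exp_neg_atTop_nhds_zero
        simpa using h1.mul (((tendsto_recessiveWeight Q).comp (hshift M)).const_mul κ))
    refine ⟨y, fun s hs => ⟨(hy s hs).1, (hy s hs).2.trans ?_⟩⟩
    rw [← mul_sub]
    simp only [columnWeight, hij, if_false]
    refine hscale hdT (mul_nonneg hκ0.le ?_)
    rw [sub_zero]
    exact (recessiveWeight_pos hQ0 (coneWeight_pos hK hs)).le

/-- A column of the fundamental solution in the coordinate `s = 1/t`: the sum of the Picard
iterates, with its asymptotics as `s → ∞` in the right half-plane. -/
theorem exists_column_solution {n : ℕ} (j : Fin n) {lam : Fin n → ℂ}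
    {A : Matrix (Fin n) (Fin n) ℂ} (hlamj : lam j = 0) (hlam : ∀ i, i ≠ j → (lam i).im ≠ 0)
    (hA : A j j = 0) :
    ∃ x : Fin n → ℂ → ℂ,
      (∀ i, ∀ s : ℂ, 0 < s.re →
        HasDerivAt (x i) (-lam i * x i s - s⁻¹ * ∑ k, A i k * x k s) s) ∧
      ∀ i, Tendsto (x i) (Bornology.cobounded ℂ ⊓ 𝓟 {s | 0 < s.re})
        (𝓝 (if i = j then 1 else 0)) := by
  obtain ⟨T, hT, hlamT⟩ : ∃ T : ℝ, 0 ≤ T ∧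
      ∀ i, i ≠ j → (lam i).re + 1 ≤ |(lam i).im| * T := by
    have hnn : ∀ i ∈ Finset.univ, 0 ≤ (|(lam i).re| + 1) / |(lam i).im| :=
      fun i _ => by positivity
    refine ⟨∑ i, (|(lam i).re| + 1) / |(lam i).im|, Finset.sum_nonneg hnn, fun i hi => ?_⟩
    have him : 0 < |(lam i).im| := abs_pos.2 (hlam i hi)
    have h1 := Finset.single_le_sum hnn (Finset.mem_univ i)
    rw [div_le_iff₀' him] at h1
    linarith [le_abs_self (lam i).re]
  obtain ⟨S, hS, hAS⟩ : ∃ S : ℝ, 0 < S ∧ ∀ i, ∑ k, ‖A i k‖ ≤ S := by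
    have hnn : ∀ i ∈ Finset.univ, 0 ≤ ∑ k, ‖A i k‖ :=
      fun i _ => Finset.sum_nonneg fun k _ => norm_nonneg _
    refine ⟨∑ i, ∑ k, ‖A i k‖ + 1, by linarith [Finset.sum_nonneg hnn], fun i => ?_⟩
    linarith [Finset.single_le_sum hnn (Finset.mem_univ i)]
  set Q := 2 * (T + 1) * ((T + 2) * S) with hQ
  have hQ0 : 0 < Q := by positivity
  have hK : 0 < T + 1 := by linarith
  set U : Set ℂ := {s | 0 < s.re} with hU
  set N := coneWeight (T + 1) with hN
  let l : Fin n → ℝ := fun i => if i = j then 1 else 0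
  have hpos : ∀ s ∈ U, 0 < N s := fun s hs => coneWeight_pos hK hs
  have step : ∀ (a : ℝ) (x : Fin n → ℂ → ℂ), 0 < a → (∀ k, DifferentiableOn ℂ (x k) U) →
      (∀ k, ∀ s ∈ U, ‖x k s‖ ≤ a * columnWeight Q j k (N s)) →
      ∃ y : Fin n → ℂ → ℂ, ∀ i, ∀ s ∈ U,
        HasDerivAt (y i) (-lam i * y i s - s⁻¹ * ∑ k, A i k * x k s) s ∧
        ‖y i s‖ ≤ a / 2 * (columnWeight Q j i (N s) - l i) := by
    intro a x ha hx hxw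
    choose y hy using fun i => exists_picard_component hT hS hQ ha (hAS i)
      (fun h => by rw [h, hlamj]) (fun h => by rw [h, hA]) (hlamT i) hx hxw
    exact ⟨y, hy⟩
  choose! P hP using step
  let X : ℕ → Fin n → ℂ → ℂ := fun m =>
    Nat.rec (fun i _ => (l i : ℂ)) (fun m x => P ((1 / 2) ^ m) x) m
  have hlw : ∀ i, ∀ s ∈ U, l i ≤ columnWeight Q j i (N s) := by
    intro i s hs
    have h0 := hpos s hs
    simp only [l]
    split_ifs with h
    · simp only [columnWeight, if_pos h]
      exact Real.one_le_exp (by positivity)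
    · exact (columnWeight_pos hQ0 h0 j i).le
  have hl0 : ∀ i, 0 ≤ l i := fun i => by
    simp only [l]
    split_ifs <;> norm_num
  have hgood : ∀ m, (∀ k, DifferentiableOn ℂ (X m k) U) ∧
      ∀ k, ∀ s ∈ U, ‖X m k s‖ ≤ (1 / 2) ^ m * columnWeight Q j k (N s) := by
    intro m
    induction m with
    | zero =>
      refine ⟨fun k => differentiableOn_const _, fun k s hs => ?_⟩
      have : ‖X 0 k s‖ = l k := by
        change ‖(l k : ℂ)‖ = l k
        rw [norm_real, Real.norm_of_nonneg (hl0 k)]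
      rw [this, pow_zero, one_mul]
      exact hlw k s hs
    | succ m ih =>
      have h := hP ((1 / 2) ^ m) (X m) (by positivity) ih.1 ih.2
      refine ⟨fun k s hs => (h k s hs).1.differentiableAt.differentiableWithinAt,
        fun k s hs => (h k s hs).2.trans ?_⟩
      rw [pow_succ, div_eq_mul_one_div]
      have : 0 ≤ (1 / 2 : ℝ) ^ m * (1 / 2) := by positivity
      exact mul_le_mul_of_nonneg_left (by linarith [hl0 k]) this
  have hstep : ∀ m i, ∀ s ∈ U,
      HasDerivAt (X (m + 1) i) (-lam i * X (m + 1) i s - s⁻¹ * ∑ k, A i k * X m k s) s ∧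
      ‖X (m + 1) i s‖ ≤ (1 / 2) ^ m / 2 * (columnWeight Q j i (N s) - l i) := fun m i s hs =>
    hP ((1 / 2) ^ m) (X m) (by positivity) (hgood m).1 (hgood m).2 i s hs
  have hgeom : Summable fun m : ℕ => (1 / 2 : ℝ) ^ m := summable_geometric_two
  have hsum : ∀ i, ∀ s ∈ U, HasSum (fun m => X m i s) (∑' m, X m i s) := fun i s hs =>
    (Summable.of_norm_bounded (hgeom.mul_right _) fun m => (hgood m).2 i s hs).hasSum
  have htail : ∀ i, ∀ s ∈ U, HasSum (fun m => X (m + 1) i s) (∑' m, X m i s - l i) := by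
    intro i s hs
    have h := (hasSum_nat_add_iff' 1).2 (hsum i s hs)
    rwa [Finset.sum_range_one] at h
  refine ⟨fun i s => ∑' m, X m i s, fun i s hs => ?_, fun i => ?_⟩
  · have hM : 0 < N s / 2 := half_pos (hpos s hs)
    set V := U ∩ {w | N s / 2 < N w} with hV
    have hVo : IsOpen V := isOpen_rightHalfPlane.inter
      (isOpen_lt continuous_const (continuous_coneWeight _))
    have hsV : s ∈ V := ⟨hs, half_lt_self (hpos s hs)⟩
    have hbd : ∀ m, ∀ w ∈ V, ‖X m i w‖ ≤ (1 / 2) ^ m * columnWeight Q j i (N s / 2) := by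
      intro m w hw
      refine ((hgood m).2 i w hw.1).trans (mul_le_mul_of_nonneg_left ?_ (by positivity))
      exact antitoneOn_columnWeight hQ0 j i hM (hpos w hw.1) (le_of_lt hw.2)
    have hdiff : ∀ m, DifferentiableOn ℂ (X m i) V := fun m =>
      ((hgood m).1 i).mono inter_subset_left
    have h1 := differentiableOn_tsum_of_summable_norm (hgeom.mul_right _) hdiff hVo hbd
    have h2 := hasSum_deriv_of_summable_norm (hgeom.mul_right _) hdiff hVo hbd hsV
    have h3 : HasSum (fun m => deriv (X (m + 1) i) s)
        (-lam i * (∑' m, X m i s - l i) - s⁻¹ * ∑ k, A i k * ∑' m, X m k s) := by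
      have h4 := ((htail i s hs).mul_left (-lam i)).sub
        ((hasSum_sum fun k (_ : k ∈ Finset.univ) => (hsum k s hs).mul_left (A i k)).mul_left s⁻¹)
      exact h4.congr_fun fun m => ((hstep m i s hs).1.deriv)
    have h5 := (hasSum_nat_add_iff' 1).2 h2
    have h6 : deriv (X 0 i) s = 0 := deriv_const s (l i : ℂ)
    rw [Finset.sum_range_one, h6, sub_zero] at h5
    have h7 : lam i * (l i : ℂ) = 0 := by
      simp only [l]
      split_ifs with h
      · simp [h, hlamj]
      · simp
    refine (h1.differentiableAt (hVo.mem_nhds hsV)).hasDerivAt.congr_deriv ?_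
    rw [h5.unique h3]
    linear_combination h7
  · have hle : ∀ s ∈ U, ‖∑' m, X m i s - l i‖ ≤ columnWeight Q j i (N s) - l i := by
      intro s hs
      rw [← (htail i s hs).tsum_eq]
      refine tsum_of_norm_bounded (hasSum_geometric_two' _) fun m => ?_
      refine (hstep m i s hs).2.trans (le_of_eq ?_)
      rw [one_div, inv_pow]
      field_simp
    have hNtop : Tendsto N (Bornology.cobounded ℂ ⊓ 𝓟 U) atTop := by
      refine tendsto_atTop_mono' _ ?_ (tendsto_norm_cobounded_atTop.mono_left inf_le_left)
      filter_upwards [mem_inf_of_right (mem_principal_self U)] with s hs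
      exact norm_le_coneWeight (by linarith) hs
    have hlim : Tendsto (fun s => columnWeight Q j i (N s) - l i)
        (Bornology.cobounded ℂ ⊓ 𝓟 U) (𝓝 0) := by
      simpa [l] using ((tendsto_columnWeight Q j i).comp hNtop).sub_const (l i)
    have hcast : (if i = j then 1 else 0 : ℂ) = (l i : ℂ) := by
      simp only [l]
      split_ifs <;> simp
    rw [hcast, tendsto_iff_norm_sub_tendsto_zero]
    refine squeeze_zero' (Eventually.of_forall fun _ => norm_nonneg _) ?_ hlim
    filter_upwards [mem_inf_of_right (mem_principal_self U)] with s hs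
    exact hle s hs

theorem mem_halfPlane_rayThrough {c : ℂ} (hc : c ≠ 0) {t : ℂ} :
    t ∈ halfPlane (rayThrough c) ↔ 0 < (t / c).re := by
  constructor
  · rintro ⟨_, ⟨τ, hτ, rfl⟩, v, hv, rfl⟩
    have : τ * c * v / c = τ * v := by field_simp
    rw [this, re_ofReal_mul]
    positivity
  · intro h
    exact ⟨c, ⟨1, one_pos, by simp⟩, t / c, h, by field_simp⟩

theorem re_div_pos_comm {c t : ℂ} : 0 < (t / c).re ↔ 0 < (c / t).re := by
  have : ∀ {w : ℂ}, 0 < w.re → 0 < w⁻¹.re := fun {w} hw => by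
    rw [inv_re]
    exact div_pos hw (normSq_pos.2 fun h => by simp [h] at hw)
  exact ⟨fun h => inv_div t c ▸ this h, fun h => inv_div c t ▸ this h⟩

theorem isOpen_halfPlane {c : ℂ} (hc : c ≠ 0) : IsOpen (halfPlane (rayThrough c)) := by
  have : halfPlane (rayThrough c) = {t | 0 < (t / c).re} := ext fun _ => mem_halfPlane_rayThrough hc
  rw [this]
  exact isOpen_lt continuous_const (by fun_prop)

theorem isPreconnected_halfPlane {c : ℂ} (hc : c ≠ 0) :
    IsPreconnected (halfPlane (rayThrough c)) := by
  have : halfPlane (rayThrough c) = {t | 0 < (t / c).re} := ext fun _ => mem_halfPlane_rayThrough hc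
  rw [this]
  refine (convex_halfSpace_gt (f := fun t : ℂ => (t / c).re) ⟨fun x y => ?_, fun a x => ?_⟩
    0).isPreconnected
  · rw [add_div, add_re]
  · rw [real_smul, mul_div_assoc, re_ofReal_mul, smul_eq_mul]

theorem ne_zero_of_mem_halfPlane {c t : ℂ} (hc : c ≠ 0) (ht : t ∈ halfPlane (rayThrough c)) :
    t ≠ 0 := by
  rintro rfl
  simp [mem_halfPlane_rayThrough hc] at ht

/-- The inversion `t ↦ c / t` sends `t → 0` in the half-plane of `c` to `∞` in the right
half-plane. -/
theorem tendsto_div_halfPlane {c : ℂ} (hc : c ≠ 0) :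
    Tendsto (fun t => c / t) (𝓝[halfPlane (rayThrough c)] 0)
      (Bornology.cobounded ℂ ⊓ 𝓟 {s | 0 < s.re}) := by
  refine tendsto_inf.2 ⟨?_, tendsto_principal.2 ?_⟩
  · have hsub : halfPlane (rayThrough c) ⊆ {0}ᶜ := fun t ht => ne_zero_of_mem_halfPlane hc ht
    exact (tendsto_mul_left_cobounded hc).comp
      (tendsto_inv₀_nhdsNE_zero.mono_left (nhdsWithin_mono _ hsub))
  · filter_upwards [self_mem_nhdsWithin] with t ht
    exact re_div_pos_comm.1 ((mem_halfPlane_rayThrough hc).1 ht)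

/-- A matrix solution of the equation with the prescribed asymptotics, not assumed invertible. -/
def IsAsymptoticSolution {n : ℕ} (z : Fin n → ℂ) (f : Matrix (Fin n) (Fin n) ℂ)
    (r : Set ℂ) (Y : ℂ → Matrix (Fin n) (Fin n) ℂ) : Prop :=
  (∀ t ∈ halfPlane r, ∀ i j : Fin n,
    HasDerivAt (fun s => Y s i j)
      ((((t ^ 2)⁻¹ • Matrix.diagonal z + t⁻¹ • f) * Y t) i j) t) ∧
  (∀ i j : Fin n,
    Tendsto (fun t => (Y t * expZt z t) i j) (𝓝[halfPlane r] 0)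
      (𝓝 (if i = j then (1 : ℂ) else 0)))

theorem exists_isAsymptoticSolution {n : ℕ} {z : Fin n → ℂ} {f : Matrix (Fin n) (Fin n) ℂ}
    {c : ℂ} (hc : c ≠ 0) (hz : ∀ i j, i ≠ j → ((z i - z j) / c).im ≠ 0) (hf : ∀ i, f i i = 0) :
    ∃ Y, IsAsymptoticSolution z f (rayThrough c) Y := by
  choose x hx hlim using fun j => exists_column_solution j (lam := fun i => (z i - z j) / c)
    (A := f) (by simp) (fun i => hz i j) (hf j)
  refine ⟨fun t => Matrix.of fun i j => x j i (c / t) * exp (-(z j / t)), fun t ht i j => ?_,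
    fun i j => ?_⟩
  · have ht0 := ne_zero_of_mem_halfPlane hc ht
    have h1 : ∀ a : ℂ, HasDerivAt (fun t => a / t) (-(a / t ^ 2)) t := fun a => by
      refine ((hasDerivAt_inv ht0).const_mul a).congr_deriv ?_
      field_simp
    have h2 := (hx j i (c / t) (re_div_pos_comm.1 ((mem_halfPlane_rayThrough hc).1 ht))).comp t
      (h1 c)
    refine (h2.mul (h1 (z j)).neg.cexp).congr_deriv ?_
    rw [Matrix.add_mul, Matrix.add_apply, Matrix.smul_mul, Matrix.smul_mul, Matrix.smul_apply,
      Matrix.smul_apply, Matrix.diagonal_mul, Matrix.mul_apply]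
    simp only [Matrix.of_apply, smul_eq_mul, Function.comp_apply, Pi.neg_apply, ← mul_assoc, ← Finset.sum_mul]
    field_simp
    ring
  · refine ((hlim j i).comp (tendsto_div_halfPlane hc)).congr fun t => ?_
    rw [expZt, Matrix.mul_diagonal]
    change x j i (c / t) = x j i (c / t) * exp (-(z j / t)) * exp (z j / t)
    rw [mul_assoc, ← exp_add, neg_add_cancel, exp_zero, mul_one]

/-- Some sequence in `H_r` tending to `0` keeps `exp (a / t)` bounded. -/
theorem exists_seq_norm_exp_le (a : ℂ) {c : ℂ} (hc : c ≠ 0) :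
    ∃ u : ℕ → ℂ, Tendsto u atTop (𝓝[halfPlane (rayThrough c)] 0) ∧
      ∃ B : ℝ, ∀ m, ‖exp (a / u m)‖ ≤ B := by
  obtain ⟨σ, hσ, hσ'⟩ : ∃ σ : ℝ, |σ| = 1 ∧ 0 ≤ (a / c).im * σ := by
    rcases le_total 0 (a / c).im with h0 | h0
    · exact ⟨1, by simp, by simpa using h0⟩
    · exact ⟨-1, by simp, by simpa using h0⟩
  let w : ℕ → ℂ := fun m => ⟨1, σ * m⟩
  have hw : Tendsto w atTop (Bornology.cobounded ℂ) := by
    refine tendsto_norm_atTop_iff_cobounded.1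
      (tendsto_atTop_mono (fun m => ?_) tendsto_natCast_atTop_atTop)
    calc (m : ℝ) = |(w m).im| := by simp [w, abs_mul, hσ]
      _ ≤ _ := abs_im_le_norm _
  refine ⟨fun m => c / w m, tendsto_nhdsWithin_iff.2 ⟨?_, Eventually.of_forall fun m => ?_⟩,
    Real.exp (a / c).re, fun m => ?_⟩
  · simpa [div_eq_mul_inv] using (tendsto_inv₀_cobounded.comp hw).const_mul c
  · rw [mem_halfPlane_rayThrough hc, re_div_pos_comm, div_div_cancel₀ hc]
    simp [w]
  · have : a / (c / w m) = a / c * w m := by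
      rw [div_div_eq_mul_div, div_mul_eq_mul_div]
    rw [this, norm_exp, Real.exp_le_exp, mul_re]
    have : 0 ≤ (a / c).im * σ * m := by positivity
    simp only [w]
    linarith

/-- Solutions of the equation and of its dual are inverse to each other, up to transposition. -/
theorem IsAsymptoticSolution.transpose_mul_eq_one {n : ℕ} {z : Fin n → ℂ}
    {f : Matrix (Fin n) (Fin n) ℂ} {c : ℂ} (hc : c ≠ 0)
    {Y V : ℂ → Matrix (Fin n) (Fin n) ℂ}
    (hY : IsAsymptoticSolution z f (rayThrough c) Y)
    (hV : IsAsymptoticSolution (-z) (-f.transpose) (rayThrough c) V) :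
    ∀ t ∈ halfPlane (rayThrough c), (V t).transpose * Y t = 1 := by
  intro t₀ ht₀
  ext i j
  set p : ℂ → ℂ := fun t => ((V t).transpose * Y t) i j with hp
  have hder : ∀ t ∈ halfPlane (rayThrough c), HasDerivAt p 0 t := by
    intro t ht
    have h := HasDerivAt.fun_sum fun k (_ : k ∈ Finset.univ) =>
      (hV.1 t ht k i).mul (hY.1 t ht k j)
    refine h.congr_deriv ?_
    rw [Finset.sum_add_distrib]
    have h1 : ((t ^ 2)⁻¹ • Matrix.diagonal (-z) + t⁻¹ • -f.transpose) =
        -((t ^ 2)⁻¹ • Matrix.diagonal z + t⁻¹ • f).transpose := by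
      ext a b
      by_cases hab : a = b
      · subst hab; simp; ring
      · simp [Matrix.diagonal_apply_ne _ hab]
    set L := (t ^ 2)⁻¹ • Matrix.diagonal z + t⁻¹ • f with hL
    have h2 : ((-L.transpose * V t).transpose * Y t + (V t).transpose * (L * Y t)) i j = 0 := by
      rw [Matrix.neg_mul, Matrix.transpose_neg, Matrix.transpose_mul, Matrix.transpose_transpose,
        Matrix.neg_mul, Matrix.mul_assoc, neg_add_cancel, Matrix.zero_apply]
    rw [h1]
    simpa only [Matrix.add_apply, Matrix.mul_apply (M := Matrix.transpose _),
      Matrix.transpose_apply] using h2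
  have hconst : ∀ t ∈ halfPlane (rayThrough c), p t = p t₀ := fun t ht =>
    (isOpen_halfPlane hc).is_const_of_deriv_eq_zero (isPreconnected_halfPlane hc)
      (fun s hs => (hder s hs).differentiableAt.differentiableWithinAt)
      (fun s hs => (hder s hs).deriv) ht ht₀
  have hlim : Tendsto (fun t => p t * exp ((z j - z i) / t)) (𝓝[halfPlane (rayThrough c)] 0)
      (𝓝 ((1 : Matrix (Fin n) (Fin n) ℂ) i j)) := by
    have h := tendsto_finsetSum Finset.univ fun k _ => (hV.2 k i).mul (hY.2 k j)
    have h1 : ∑ k, (if k = i then (1 : ℂ) else 0) * (if k = j then 1 else 0) =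
        (1 : Matrix (Fin n) (Fin n) ℂ) i j := by
      simp [Matrix.one_apply, eq_comm]
    rw [h1] at h
    refine h.congr fun t => ?_
    simp only [hp, expZt, Matrix.mul_diagonal, Matrix.mul_apply (M := Matrix.transpose _),
      Matrix.transpose_apply, Finset.sum_mul, Pi.neg_apply]
    refine Finset.sum_congr rfl fun k _ => ?_
    rw [show (z j - z i) / t = -z i / t + z j / t by ring, exp_add]
    ring
  obtain ⟨u, hu, B, hB⟩ := exists_seq_norm_exp_le (z i - z j) hc
  have hlim' := hlim.comp hu
  change p t₀ = (1 : Matrix (Fin n) (Fin n) ℂ) i j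
  have hmem : ∀ᶠ m in atTop, u m ∈ halfPlane (rayThrough c) :=
    hu.eventually self_mem_nhdsWithin
  by_cases hij : i = j
  · refine tendsto_nhds_unique (tendsto_const_nhds.congr' ?_) hlim'
    filter_upwards [hmem] with m hm
    simp [hij, hconst _ hm]
  · rw [Matrix.one_apply_ne hij] at hlim' ⊢
    have hbdd := hlim'.zero_mul_isBoundedUnder_le
      (g := fun m => exp ((z i - z j) / u m)) ⟨B, eventually_map.2 (Eventually.of_forall hB)⟩
    refine tendsto_nhds_unique (tendsto_const_nhds.congr' ?_) hbdd
    filter_upwards [hmem] with m hm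
    rw [Function.comp_apply, hconst _ hm, mul_assoc, ← exp_add]
    rw [← add_div, sub_add_sub_cancel, sub_self, zero_div, exp_zero, mul_one]

theorem im_div_ne_zero_of_isAdmissibleRay {n : ℕ} {z : Fin n → ℂ} {c : ℂ} (hc : c ≠ 0)
    (hz : ∀ i j : Fin n, i ≠ j → z i ≠ z j) (hr : ¬ IsStokesRay z (rayThrough c)) :
    ∀ i j, i ≠ j → ((z i - z j) / c).im ≠ 0 := by
  have hpos : ∀ i j, i ≠ j → ((z i - z j) / c).im = 0 → ((z i - z j) / c).re ≤ 0 := by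
    intro i j hij him
    by_contra! hre
    set τ := ((z i - z j) / c).re with hτ
    have hzc : z i - z j = τ * c := by
      rw [← div_eq_iff hc]
      exact Complex.ext (by simp [hτ]) (by simpa using him)
    refine hr ⟨i, j, hij, ?_⟩
    rw [hzc]
    have hτ0 : (τ : ℂ) ≠ 0 := by exact_mod_cast hre.ne'
    ext w
    constructor
    · rintro ⟨t, ht, rfl⟩
      exact ⟨t / τ, div_pos ht hre, by push_cast; field_simp⟩
    · rintro ⟨t, ht, rfl⟩
      exact ⟨t * τ, mul_pos ht hre, by push_cast; ring⟩
  intro i j hij him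
  have hneg : (z j - z i) / c = -((z i - z j) / c) := by ring
  have h1 := hpos i j hij him
  have h2 := hpos j i hij.symm (by rw [hneg, neg_im, him, neg_zero])
  rw [hneg, neg_re] at h2
  have h0 : (z i - z j) / c = 0 := Complex.ext (by simp only [zero_re]; linarith) him
  rcases div_eq_zero_iff.1 h0 with h | h
  · exact hz i j hij (sub_eq_zero.1 h)
  · exact hc h

end

/-- **Existence and uniqueness of canonical fundamental solutions** (case
`G = GLₙ(ℂ)`): for `Z = diag(z₁,…,zₙ)` with pairwise distinct entries, `f` with
zero diagonal, and an admissible ray `r`, there is a unique holomorphic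
`Y : H_r → GLₙ(ℂ)` with `Y′(t) = (Z/t² + f/t)·Y(t)` and `Y(t)·exp(Z/t) → 1` as
`t → 0` in `H_r`. -/
theorem existsUnique_canonicalSolution {n : ℕ} (hn : 1 ≤ n) (z : Fin n → ℂ)
    (hz : ∀ i j : Fin n, i ≠ j → z i ≠ z j) (f : Matrix (Fin n) (Fin n) ℂ)
    (hf : ∀ i, f i i = 0) (r : Set ℂ) (hr : IsAdmissibleRay z r) :
    ∃ Y : ℂ → Matrix (Fin n) (Fin n) ℂ, IsCanonicalSolution z f r Y ∧
      ∀ Y' : ℂ → Matrix (Fin n) (Fin n) ℂ, IsCanonicalSolution z f r Y' →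
        Set.EqOn Y Y' (halfPlane r) := by
  obtain ⟨⟨c, hc, rfl⟩, hr⟩ := hr
  have him := im_div_ne_zero_of_isAdmissibleRay hc hz hr
  obtain ⟨Y, hY⟩ := exists_isAsymptoticSolution hc him hf
  obtain ⟨V, hV⟩ := exists_isAsymptoticSolution (z := -z) (f := -f.transpose) hc
    (fun i j hij => by
      rw [Pi.neg_apply, Pi.neg_apply, neg_sub_neg]
      exact him j i hij.symm)
    (fun i => by simp [hf])
  have hinv := hY.transpose_mul_eq_one hc hV
  refine ⟨Y, ⟨fun t ht => .of_mul_eq_one_right _ (hinv t ht), hY.1, hY.2⟩,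
    fun Y' hY' t ht => ?_⟩
  have hinv' := IsAsymptoticSolution.transpose_mul_eq_one hc ⟨hY'.2.1, hY'.2.2⟩ hV t ht
  calc Y t = Y t * ((V t).transpose * Y' t) := by rw [hinv', mul_one]
    _ = Y' t := by rw [← mul_assoc, mul_eq_one_comm.1 (hinv t ht), one_mul]
end

section
/- Local solvability and uniqueness for the isomonodromy equations (case G = GLₙ(ℂ)): let Z₀ ∈ ℂⁿ have pairwise distinct coordinates and let f⁰ be an n×n complex matrix with zero diagonal entries. Then there exist an open connected neighbourhood U of Z₀ contained in {z ∈ ℂⁿ : z_i ≠ z_j for all i ≠ j} and a holomorphic map f : U → Matₙ(ℂ) with f(Z₀) = f⁰, with zero diagonal entries, and satisfying for all z ∈ U, all i ≠ j, and all 1 ≤ m ≤ n the partial differential equations ∂f_{ij}/∂z_m (z) = Σ_{k ≠ i,j} f_{ik}(z)·f_{kj}(z)·[(δ_{km} − δ_{jm})/(z_k − z_j) − (δ_{im} − δ_{km})/(z_i − z_k)] (where δ denotes the Kronecker delta); moreover any two holomorphic maps with these properties agree on a neighbourhood of Z₀. -/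
open Complex Filter Topology

/-- `f` is a holomorphic solution on `U` of the isomonodromy equations for
`GLₙ(ℂ)`: it has zero diagonal entries, is holomorphic, and satisfies
`∂f_{ij}/∂z_m = Σ_{k ≠ i,j} f_{ik} f_{kj} [(δ_{km} − δ_{jm})/(z_k − z_j)
− (δ_{im} − δ_{km})/(z_i − z_k)]` for all `i ≠ j` and all `m`. -/
def SolvesIsomonodromy {n : ℕ} (U : Set (Fin n → ℂ))
    (f : (Fin n → ℂ) → Matrix (Fin n) (Fin n) ℂ) : Prop :=
  (∀ w ∈ U, ∀ i, f w i i = 0) ∧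
  (∀ w ∈ U, ∀ i j : Fin n, DifferentiableAt ℂ (fun v => f v i j) w) ∧
  (∀ w ∈ U, ∀ i j : Fin n, i ≠ j → ∀ m : Fin n,
    fderiv ℂ (fun v => f v i j) w (Pi.single m 1) =
      ∑ k ∈ (Finset.univ \ {i, j} : Finset (Fin n)), f w i k * f w k j *
        (((if k = m then (1 : ℂ) else 0) - (if j = m then 1 else 0)) / (w k - w j) -
          ((if i = m then (1 : ℂ) else 0) - (if k = m then 1 else 0)) / (w i - w k)))

/-- The value `(v_k - v_j) / (z_k - z_j)` of the one-form `d log (z_k - z_j)` at `z` on `v`. -/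
noncomputable def dlogDiff {n : ℕ} (z v : Fin n → ℂ) (k j : Fin n) : ℂ :=
  (v k - v j) / (z k - z j)

/-- The right-hand side of the isomonodromy equations at the point `z`, for the matrix `y`, in the
direction `v`. -/
noncomputable def isoField {n : ℕ} (z : Fin n → ℂ) (y : Fin n → Fin n → ℂ) (v : Fin n → ℂ)
    (i j : Fin n) : ℂ :=
  ∑ k, y i k * y k j * (dlogDiff z v k j - dlogDiff z v i k)

/-- The derivative of `isoField z y v` with respect to `y` in the direction `p`. -/
noncomputable def isoFieldLin {n : ℕ} (z : Fin n → ℂ) (y p : Fin n → Fin n → ℂ) (v : Fin n → ℂ)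
    (i j : Fin n) : ℂ :=
  ∑ k, (p i k * y k j + y i k * p k j) * (dlogDiff z v k j - dlogDiff z v i k)

/-- The derivative of `isoField z y v` with respect to `z` in the direction `w`. -/
noncomputable def isoFieldBase {n : ℕ} (z : Fin n → ℂ) (y : Fin n → Fin n → ℂ) (w v : Fin n → ℂ)
    (i j : Fin n) : ℂ :=
  ∑ k, y i k * y k j *
    (dlogDiff z w i k * dlogDiff z v i k - dlogDiff z w k j * dlogDiff z v k j)

section Algebra

variable {n : ℕ} (z : Fin n → ℂ) (y : Fin n → Fin n → ℂ) (v w : Fin n → ℂ)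

@[simp] lemma dlogDiff_self (k : Fin n) : dlogDiff z v k k = 0 := by simp [dlogDiff]

lemma dlogDiff_comm (k j : Fin n) : dlogDiff z v k j = dlogDiff z v j k := by
  rw [dlogDiff, dlogDiff, ← neg_sub (v j), ← neg_sub (z j), neg_div_neg_eq]

lemma dlogDiff_smul (c : ℂ) (k j : Fin n) : dlogDiff z (c • v) k j = c * dlogDiff z v k j := by
  simp only [dlogDiff, Pi.smul_apply, smul_eq_mul]
  ring

lemma isoField_diag (i : Fin n) : isoField z y v i i = 0 :=
  Finset.sum_eq_zero fun k _ => by rw [dlogDiff_comm z v k i, sub_self, mul_zero]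

lemma isoField_smul (c : ℂ) (i j : Fin n) :
    isoField z y (c • v) i j = c * isoField z y v i j := by
  simp only [isoField, dlogDiff_smul, Finset.mul_sum]
  exact Finset.sum_congr rfl fun k _ => by ring

lemma isoFieldBase_comm (i j : Fin n) : isoFieldBase z y w v i j = isoFieldBase z y v w i j :=
  Finset.sum_congr rfl fun k _ => by ring

lemma isoFieldLin_sub (p q : Fin n → Fin n → ℂ) (i j : Fin n) :
    isoFieldLin z y (fun i j => p i j - q i j) v i j =
      isoFieldLin z y p v i j - isoFieldLin z y q v i j := by
  simp only [isoFieldLin, ← Finset.sum_sub_distrib]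
  exact Finset.sum_congr rfl fun k _ => by ring

lemma isoFieldLin_smul_comm (c : ℂ) (p : Fin n → Fin n → ℂ) (i j : Fin n) :
    isoFieldLin z y p (c • v) i j = isoFieldLin z y (fun i j => c * p i j) v i j := by
  simp only [isoFieldLin, dlogDiff_smul]
  exact Finset.sum_congr rfl fun k _ => by ring

lemma isoFieldLin_smul (c : ℂ) (p : Fin n → Fin n → ℂ) (i j : Fin n) :
    isoFieldLin z y p (c • v) i j = c * isoFieldLin z y p v i j := by
  simp only [isoFieldLin, dlogDiff_smul, Finset.mul_sum]
  exact Finset.sum_congr rfl fun k _ => by ring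

/-- The Arnold relation between the forms `d log (z_i - z_j)`. -/
lemma dlogDiff_arnold (hz : ∀ i j, i ≠ j → z i ≠ z j) (i j k : Fin n) :
    dlogDiff z w i k * dlogDiff z v k j - dlogDiff z v i k * dlogDiff z w k j
      + (dlogDiff z w k j - dlogDiff z w i k) * dlogDiff z v i j
      - (dlogDiff z v k j - dlogDiff z v i k) * dlogDiff z w i j = 0 := by
  rcases eq_or_ne i k with rfl | hik
  · simp only [dlogDiff_self]; ring
  rcases eq_or_ne k j with rfl | hkj
  · simp only [dlogDiff_self]; ring
  rcases eq_or_ne i j with rfl | hij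
  · rw [dlogDiff_comm z w k i, dlogDiff_comm z v k i]; ring
  have h₁ := sub_ne_zero.2 (hz _ _ hik)
  have h₂ := sub_ne_zero.2 (hz _ _ hkj)
  have h₃ := sub_ne_zero.2 (hz _ _ hij)
  simp only [dlogDiff]
  field_simp
  ring

/-- The isomonodromy equations are integrable. -/
lemma isoFieldLin_isoField_comm (hz : ∀ i j, i ≠ j → z i ≠ z j) (i j : Fin n) :
    isoFieldLin z y (isoField z y w) v i j = isoFieldLin z y (isoField z y v) w i j := by
  let M : Matrix (Fin n) (Fin n) ℂ := Matrix.of y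
  let had (p : Matrix (Fin n) (Fin n) ℂ) (u : Fin n → ℂ) : Matrix (Fin n) (Fin n) ℂ :=
    Matrix.of fun i j => p i j * dlogDiff z u i j
  have hF (u : Fin n → ℂ) : Matrix.of (isoField z y u) = M * had M u - had M u * M := by
    ext i j
    simp only [Matrix.sub_apply, Matrix.mul_apply, Matrix.of_apply, isoField, M, had,
      ← Finset.sum_sub_distrib]
    exact Finset.sum_congr rfl fun k _ => by ring
  have hL (p : Fin n → Fin n → ℂ) (u : Fin n → ℂ) : Matrix.of (isoFieldLin z y p u) =
      (Matrix.of p * had M u - had M u * Matrix.of p) +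
        (M * had (Matrix.of p) u - had (Matrix.of p) u * M) := by
    ext i j
    simp only [Matrix.sub_apply, Matrix.add_apply, Matrix.mul_apply, Matrix.of_apply, isoFieldLin,
      M, had, ← Finset.sum_sub_distrib, ← Finset.sum_add_distrib]
    exact Finset.sum_congr rfl fun k _ => by ring
  have hA : had (Matrix.of (isoField z y w)) v = had (Matrix.of (isoField z y v)) w +
      (had M v * had M w - had M w * had M v) := by
    ext i j
    simp only [Matrix.sub_apply, Matrix.add_apply, Matrix.mul_apply, Matrix.of_apply, isoField,
      M, had, ← Finset.sum_sub_distrib, Finset.sum_mul, ← Finset.sum_add_distrib]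
    refine Finset.sum_congr rfl fun k _ => ?_
    linear_combination y i k * y k j * dlogDiff_arnold z v w hz i j k
  have key : Matrix.of (isoFieldLin z y (isoField z y w) v) =
      Matrix.of (isoFieldLin z y (isoField z y v) w) := by
    rw [hL, hL, hA, hF, hF]
    noncomm_ring
  exact congrFun (congrFun key i) j

end Algebra

section Derivatives

variable {n : ℕ}

lemma HasDerivAt.dlogDiff {z u : ℂ → Fin n → ℂ} {z' u' : Fin n → ℂ} {t : ℂ}
    (hz : HasDerivAt z z' t) (hu : HasDerivAt u u' t) (hreg : ∀ i j, i ≠ j → z t i ≠ z t j)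
    (k j : Fin n) :
    HasDerivAt (fun s => dlogDiff (z s) (u s) k j)
      (dlogDiff (z t) u' k j - dlogDiff (z t) z' k j * dlogDiff (z t) (u t) k j) t := by
  rcases eq_or_ne k j with rfl | hkj
  · simpa using hasDerivAt_const t (0 : ℂ)
  rw [hasDerivAt_pi] at hz hu
  have h := sub_ne_zero.2 (hreg _ _ hkj)
  refine (((hu k).fun_sub (hu j)).fun_div ((hz k).fun_sub (hz j)) h).congr_deriv ?_
  simp only [_root_.dlogDiff]
  field_simp

lemma HasDerivAt.isoField {z u : ℂ → Fin n → ℂ} {y : ℂ → Fin n → Fin n → ℂ}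
    {z' u' : Fin n → ℂ} {y' : Fin n → Fin n → ℂ} {t : ℂ}
    (hz : HasDerivAt z z' t) (hy : ∀ i j, HasDerivAt (fun s => y s i j) (y' i j) t)
    (hu : HasDerivAt u u' t) (hreg : ∀ i j, i ≠ j → z t i ≠ z t j) (i j : Fin n) :
    HasDerivAt (fun s => isoField (z s) (y s) (u s) i j)
      (isoFieldLin (z t) (y t) y' (u t) i j + isoFieldBase (z t) (y t) z' (u t) i j
        + isoField (z t) (y t) u' i j) t := by
  have h := HasDerivAt.fun_sum (u := Finset.univ) fun k _ =>
    ((hy i k).fun_mul (hy k j)).fun_mul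
      ((hz.dlogDiff hu hreg k j).fun_sub (hz.dlogDiff hu hreg i k))
  refine h.congr_deriv ?_
  simp only [isoFieldLin, isoFieldBase, _root_.isoField, ← Finset.sum_add_distrib]
  exact Finset.sum_congr rfl fun k _ => by ring

/-- The derivative along a curve of the defect of the isomonodromy equations. -/
lemma hasDerivAt_fderiv_sub_isoField {f : (Fin n → ℂ) → Fin n → Fin n → ℂ}
    {c u : ℂ → Fin n → ℂ} {c' u' : Fin n → ℂ} {t : ℂ}
    (hf : ∀ i j, ContDiffAt ℂ 2 (fun x => f x i j) (c t)) (hc : HasDerivAt c c' t)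
    (hu : HasDerivAt u u' t) (hreg : ∀ i j, i ≠ j → c t i ≠ c t j) (i j : Fin n) :
    HasDerivAt (fun s => fderiv ℂ (fun x => f x i j) (c s) (u s)
        - isoField (c s) (f (c s)) (u s) i j)
      (fderiv ℂ (fderiv ℂ fun x => f x i j) (c t) c' (u t) + fderiv ℂ (fun x => f x i j) (c t) u'
        - (isoFieldLin (c t) (f (c t)) (fun i j => fderiv ℂ (fun x => f x i j) (c t) c') (u t) i j
          + isoFieldBase (c t) (f (c t)) c' (u t) i j + isoField (c t) (f (c t)) u' i j)) t := by
  have hd (i j : Fin n) : HasFDerivAt (fun x => f x i j) (fderiv ℂ (fun x => f x i j) (c t)) (c t) :=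
    ((hf i j).differentiableAt (by norm_num)).hasFDerivAt
  have hdd : HasFDerivAt (fderiv ℂ fun x => f x i j)
      (fderiv ℂ (fderiv ℂ fun x => f x i j) (c t)) (c t) :=
    (((hf i j).fderiv_right (m := 1) (by norm_num)).differentiableAt (by norm_num)).hasFDerivAt
  exact ((hdd.comp_hasDerivAt t hc).clm_apply hu).fun_sub
    (HasDerivAt.isoField (y := fun s => f (c s)) hc
      (fun i j => (hd i j).comp_hasDerivAt t hc) hu hreg i j)

end Derivatives

section Frobenius

variable {n : ℕ}

lemma add_smul_mem_ball {Z₀ v : Fin n → ℂ} {r : ℝ} (hv : v ∈ Metric.ball 0 r) {t : ℝ}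
    (ht : t ∈ Set.Icc (0 : ℝ) 1) : Z₀ + (t : ℂ) • v ∈ Metric.ball Z₀ r := by
  rw [mem_ball_zero_iff] at hv
  rw [mem_ball_iff_norm, add_sub_cancel_left, norm_smul]
  refine (mul_le_of_le_one_left (norm_nonneg _) ?_).trans_lt hv
  simpa [abs_of_nonneg ht.1] using ht.2

lemma norm_isoFieldLin_le (z : Fin n → ℂ) (y p : Fin n → Fin n → ℂ) (v : Fin n → ℂ) :
    ‖isoFieldLin z y p v‖ ≤
      (∑ i, ∑ j, ∑ k, (‖y k j‖ + ‖y i k‖) * ‖dlogDiff z v k j - dlogDiff z v i k‖) * ‖p‖ := by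
  have hp (i j : Fin n) : ‖p i j‖ ≤ ‖p‖ := (norm_le_pi_norm _ j).trans (norm_le_pi_norm p i)
  have hpos : 0 ≤ (∑ i, ∑ j, ∑ k, (‖y k j‖ + ‖y i k‖) *
      ‖dlogDiff z v k j - dlogDiff z v i k‖) * ‖p‖ := by positivity
  refine (pi_norm_le_iff_of_nonneg hpos).2 fun i => (pi_norm_le_iff_of_nonneg hpos).2 fun j => ?_
  calc ‖isoFieldLin z y p v i j‖
      ≤ ∑ k, ((‖y k j‖ + ‖y i k‖) * ‖dlogDiff z v k j - dlogDiff z v i k‖) * ‖p‖ := by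
        refine norm_sum_le_of_le _ fun k _ => ?_
        rw [norm_mul, mul_right_comm]
        gcongr
        refine (norm_add_le _ _).trans ?_
        rw [norm_mul, norm_mul, add_mul, mul_comm ‖p i k‖]
        gcongr <;> exact hp _ _
    _ ≤ _ := by
        rw [← Finset.sum_mul]
        refine mul_le_mul_of_nonneg_right ?_ (norm_nonneg _)
        exact (Finset.single_le_sum (f := fun j => ∑ k, (‖y k j‖ + ‖y i k‖) *
            ‖dlogDiff z v k j - dlogDiff z v i k‖)
            (fun j _ => by positivity) (Finset.mem_univ j)).trans
          (Finset.single_le_sum (f := fun i => ∑ j, ∑ k, (‖y k j‖ + ‖y i k‖) *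
            ‖dlogDiff z v k j - dlogDiff z v i k‖)
            (fun i _ => by positivity) (Finset.mem_univ i))

/-- A solution of a linear equation `p' = isoFieldLin z y p v` along a curve vanishes if it
vanishes initially. -/
lemma eq_zero_of_hasDerivAt_isoFieldLin {z : ℝ → Fin n → ℂ} {y p : ℝ → Fin n → Fin n → ℂ}
    {v : Fin n → ℂ} (hz : ContinuousOn z (Set.Icc 0 1)) (hy : ContinuousOn y (Set.Icc 0 1))
    (hreg : ∀ t ∈ Set.Icc (0 : ℝ) 1, ∀ i j, i ≠ j → z t i ≠ z t j) (hp₀ : p 0 = 0)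
    (hp : ∀ t ∈ Set.Icc (0 : ℝ) 1, ∀ i j,
      HasDerivAt (fun s => p s i j) (isoFieldLin (z t) (y t) (p t) v i j) t) :
    ∀ t ∈ Set.Icc (0 : ℝ) 1, p t = 0 := by
  have hp' (t : ℝ) (ht : t ∈ Set.Icc (0 : ℝ) 1) :
      HasDerivAt p (isoFieldLin (z t) (y t) (p t) v) t :=
    hasDerivAt_pi.2 fun i => hasDerivAt_pi.2 fun j => hp t ht i j
  have hdlog (k j : Fin n) : ContinuousOn (fun t => dlogDiff (z t) v k j) (Set.Icc 0 1) := by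
    rcases eq_or_ne k j with rfl | hkj
    · simpa using continuousOn_const
    · refine continuousOn_const.div (by fun_prop) fun t ht => sub_ne_zero.2 (hreg t ht _ _ hkj)
  have hcont : ContinuousOn (fun t => ∑ i, ∑ j, ∑ k, (‖y t k j‖ + ‖y t i k‖) *
      ‖dlogDiff (z t) v k j - dlogDiff (z t) v i k‖) (Set.Icc 0 1) := by
    fun_prop
  obtain ⟨K, hK⟩ := isCompact_Icc.bddAbove_image hcont
  refine eq_zero_of_abs_deriv_le_mul_abs_self_of_eq_zero_right (K := K)
    (fun t ht => (hp' t ht).continuousAt.continuousWithinAt)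
    (fun t ht => (hp' t (Set.Ico_subset_Icc_self ht)).hasDerivWithinAt) hp₀ fun t ht => ?_
  refine (norm_isoFieldLin_le _ _ _ _).trans ?_
  gcongr
  exact hK ⟨t, Set.Ico_subset_Icc_self ht, rfl⟩

/-- The derivative of the radial part of the isomonodromy equations in the direction `w`. -/
lemma fderiv_fderiv_add_of_radial {Z₀ : Fin n → ℂ} {f : (Fin n → ℂ) → Fin n → Fin n → ℂ}
    {z : Fin n → ℂ} (hreg : ∀ i j, i ≠ j → z i ≠ z j)
    (hf : ∀ i j, ContDiffAt ℂ 2 (fun x => f x i j) z)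
    (hrad : ∀ᶠ z in 𝓝 z, ∀ i j,
      fderiv ℂ (fun x => f x i j) z (z - Z₀) = isoField z (f z) (z - Z₀) i j)
    (w : Fin n → ℂ) (i j : Fin n) :
    fderiv ℂ (fderiv ℂ fun x => f x i j) z w (z - Z₀) + fderiv ℂ (fun x => f x i j) z w =
      isoFieldLin z (f z) (fun i j => fderiv ℂ (fun x => f x i j) z w) (z - Z₀) i j
        + isoFieldBase z (f z) w (z - Z₀) i j + isoField z (f z) w i j := by
  have hl : HasDerivAt (fun s : ℂ => z + s • w) w 0 := by
    simpa using ((hasDerivAt_id (0 : ℂ)).smul_const w).const_add z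
  have h0 : z + (0 : ℂ) • w = z := by simp
  have h := hasDerivAt_fderiv_sub_isoField (c := fun s : ℂ => z + s • w) (by simpa using hf)
    hl (hl.sub_const Z₀) (by simpa using hreg) i j
  simp only [h0] at h
  have hs : Tendsto (fun s : ℂ => z + s • w) (𝓝 0) (𝓝 z) := by
    simpa only [h0] using hl.continuousAt.tendsto
  refine sub_eq_zero.1 (h.unique ((hasDerivAt_const (0 : ℂ) (0 : ℂ)).congr_of_eventuallyEq ?_))
  filter_upwards [hs.eventually hrad] with s hs
  exact sub_eq_zero.2 (hs i j)

/-- The defect of the isomonodromy equations in the direction `w`, multiplied by `t`, satisfies a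
linear equation along the ray `t ↦ Z₀ + t • v`. -/
lemma hasDerivAt_defect_of_radial {Z₀ v : Fin n → ℂ} {f : (Fin n → ℂ) → Fin n → Fin n → ℂ} {t : ℂ}
    (hreg : ∀ i j, i ≠ j → (Z₀ + t • v) i ≠ (Z₀ + t • v) j)
    (hf : ∀ i j, ContDiffAt ℂ 2 (fun x => f x i j) (Z₀ + t • v))
    (hrad : ∀ᶠ z in 𝓝 (Z₀ + t • v), ∀ i j,
      fderiv ℂ (fun x => f x i j) z (z - Z₀) = isoField z (f z) (z - Z₀) i j)
    (w : Fin n → ℂ) (i j : Fin n) :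
    HasDerivAt (fun s : ℂ => s * (fderiv ℂ (fun x => f x i j) (Z₀ + s • v) w
        - isoField (Z₀ + s • v) (f (Z₀ + s • v)) w i j))
      (isoFieldLin (Z₀ + t • v) (f (Z₀ + t • v))
        (fun i j => t * (fderiv ℂ (fun x => f x i j) (Z₀ + t • v) w
          - isoField (Z₀ + t • v) (f (Z₀ + t • v)) w i j)) v i j) t := by
  have hl : HasDerivAt (fun s : ℂ => Z₀ + s • v) v t := by
    simpa using ((hasDerivAt_id t).smul_const v).const_add Z₀
  refine ((hasDerivAt_id t).fun_mul (hasDerivAt_fderiv_sub_isoField hf hl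
    (hasDerivAt_const t w) hreg i j)).congr_deriv ?_
  have e₁ := fderiv_fderiv_add_of_radial hreg hf hrad w i j
  have e₂ (i j : Fin n) := hrad.self_of_nhds i j
  have e₃ := (hf i j).isSymmSndFDerivAt (by simp) v w
  simp only [add_sub_cancel_left] at e₁ e₂
  generalize Z₀ + t • v = x at *
  have e₄ := isoFieldLin_isoField_comm x (f x) (t • v) w hreg i j
  have e₅ : isoField x (f x) (t • v) = fun i j => t * fderiv ℂ (fun x => f x i j) x v := by
    ext i j
    rw [← e₂ i j, map_smul, smul_eq_mul]
  have e₆ := isoFieldBase_comm x (f x) w v i j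
  have e₇ : isoFieldBase x (f x) w (t • v) i j = t * isoFieldBase x (f x) w v i j := by
    simp only [isoFieldBase, dlogDiff_smul, Finset.mul_sum]
    exact Finset.sum_congr rfl fun k _ => by ring
  rw [e₅, ← isoFieldLin_smul_comm x (f x) w, isoFieldLin_smul x (f x) w] at e₄
  rw [← isoFieldLin_smul_comm, isoFieldLin_sub, e₄]
  rw [map_smul, smul_eq_mul, e₇, ← e₃] at e₁
  have e₈ : isoField x (f x) 0 i j = 0 := by
    simpa using isoField_smul x (f x) 0 0 i j
  simp only [id, map_zero, e₈]
  linear_combination e₁ - t * e₆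

/-- A function satisfying the isomonodromy equations in the radial direction satisfies them in all
directions. -/
lemma fderiv_eq_isoField_of_radial {Z₀ : Fin n → ℂ} {r : ℝ}
    {f : (Fin n → ℂ) → Fin n → Fin n → ℂ}
    (hreg : ∀ z ∈ Metric.ball Z₀ r, ∀ i j, i ≠ j → z i ≠ z j)
    (hf : ∀ z ∈ Metric.ball Z₀ r, ∀ i j, ContDiffAt ℂ 2 (fun x => f x i j) z)
    (hrad : ∀ z ∈ Metric.ball Z₀ r, ∀ i j,
      fderiv ℂ (fun x => f x i j) z (z - Z₀) = isoField z (f z) (z - Z₀) i j)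
    {z : Fin n → ℂ} (hz : z ∈ Metric.ball Z₀ r) (w : Fin n → ℂ) (i j : Fin n) :
    fderiv ℂ (fun x => f x i j) z w = isoField z (f z) w i j := by
  obtain ⟨v, rfl⟩ : ∃ v, z = Z₀ + v := ⟨z - Z₀, by simp⟩
  have hv : v ∈ Metric.ball 0 r := by simpa [mem_ball_iff_norm] using hz
  have hmem (t : ℝ) (ht : t ∈ Set.Icc (0 : ℝ) 1) := add_smul_mem_ball (Z₀ := Z₀) hv ht
  have hvanish := eq_zero_of_hasDerivAt_isoFieldLin (z := fun t : ℝ => Z₀ + (t : ℂ) • v)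
    (y := fun t => f (Z₀ + (t : ℂ) • v)) (v := v)
    (p := fun t i j => (t : ℂ) * (fderiv ℂ (fun x => f x i j) (Z₀ + (t : ℂ) • v) w
      - isoField (Z₀ + (t : ℂ) • v) (f (Z₀ + (t : ℂ) • v)) w i j))
    (by fun_prop)
    (continuousOn_pi.2 fun i => continuousOn_pi.2 fun j t ht =>
      ((hf _ (hmem t ht) i j).continuousAt.comp (f := fun t : ℝ => Z₀ + (t : ℂ) • v)
        (by fun_prop)).continuousWithinAt)
    (fun t ht => hreg _ (hmem t ht)) (by ext; simp)
    (fun t ht i j => (hasDerivAt_defect_of_radial (hreg _ (hmem t ht)) (hf _ (hmem t ht))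
      (Filter.mem_of_superset (Metric.isOpen_ball.mem_nhds (hmem t ht)) hrad) w i j).comp_ofReal)
    1 (by simp)
  have := congrFun (congrFun hvanish i) j
  simpa [sub_eq_zero] using this

end Frobenius

section Rays

open unitInterval

/-- The operator sending a continuous function on the unit interval to its primitive vanishing
at `0`. -/
noncomputable def primitive : C(I, ℂ) →L[ℂ] C(I, ℂ) :=
  LinearMap.mkContinuous
    { toFun a := ⟨fun t => ∫ s in (0 : ℝ)..t, Set.IccExtend zero_le_one a s,
        (intervalIntegral.continuous_primitive
          (fun _ _ => (a.continuous.Icc_extend').intervalIntegrable _ _) 0).comp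
            continuous_subtype_val⟩
      map_add' a b := by
        ext t
        exact intervalIntegral.integral_add
          ((a.continuous.Icc_extend').intervalIntegrable _ _)
          ((b.continuous.Icc_extend').intervalIntegrable _ _)
      map_smul' c a := by
        ext t
        exact intervalIntegral.integral_smul c _ } 1 fun a => by
    rw [one_mul, ContinuousMap.norm_le _ (norm_nonneg a)]
    intro t
    refine (intervalIntegral.norm_integral_le_of_norm_le_const
      (C := ‖a‖) fun s _ => a.norm_coe_le_norm _).trans ?_
    refine mul_le_of_le_one_right (norm_nonneg a) ?_
    simpa [abs_of_nonneg t.2.1] using t.2.2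

lemma primitive_apply (a : C(I, ℂ)) (t : I) :
    primitive a t = ∫ s in (0 : ℝ)..t, Set.IccExtend zero_le_one a s := rfl

variable {n : ℕ}

/-- The pullback of `d log (z_k - z_j)` to the ray `t ↦ Z₀ + t • v`, as a continuous function. -/
noncomputable def rayForm (Z₀ v : Fin n → ℂ) (k j : Fin n) : C(I, ℂ) :=
  (v k - v j) • Ring.inverse (ContinuousMap.const I (Z₀ k - Z₀ j)
    + (v k - v j) • (⟨fun t => ((t : ℝ) : ℂ), by fun_prop⟩ : C(I, ℂ)))

@[simp] lemma rayForm_zero (Z₀ : Fin n → ℂ) (k j : Fin n) : rayForm Z₀ 0 k j = 0 := by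
  ext t
  simp [rayForm]

lemma contDiffAt_rayForm {Z₀ : Fin n → ℂ} (hZ₀ : ∀ i j, i ≠ j → Z₀ i ≠ Z₀ j) (k j : Fin n) :
    ContDiffAt ℂ 2 (fun v => rayForm Z₀ v k j) 0 := by
  rcases eq_or_ne k j with rfl | hkj
  · simpa [rayForm] using contDiffAt_const
  have hu : IsUnit (ContinuousMap.const I (Z₀ k - Z₀ j) : C(I, ℂ)) :=
    (ContinuousMap.isUnit_iff_forall_ne_zero _).2 fun t => sub_ne_zero.2 (hZ₀ _ _ hkj)
  have hsub : ContDiff ℂ 2 fun v : Fin n → ℂ => v k - v j := by fun_prop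
  refine hsub.contDiffAt.smul (ContDiffAt.comp (g := Ring.inverse) 0 ?_
    (contDiff_const.add (hsub.smul contDiff_const)).contDiffAt)
  have h0 : ContinuousMap.const I (Z₀ k - Z₀ j) + ((0 : Fin n → ℂ) k - (0 : Fin n → ℂ) j) •
      (⟨fun t => ((t : ℝ) : ℂ), by fun_prop⟩ : C(I, ℂ)) = hu.unit := by
    ext t
    simp
  rw [h0]
  exact contDiffAt_ringInverse ℂ hu.unit

lemma rayForm_apply {Z₀ v : Fin n → ℂ}
    (hreg : ∀ t ∈ Set.Icc (0 : ℝ) 1, ∀ i j, i ≠ j →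
      (Z₀ + (t : ℂ) • v) i ≠ (Z₀ + (t : ℂ) • v) j) (k j : Fin n) (t : I) :
    rayForm Z₀ v k j t = dlogDiff (Z₀ + ((t : ℝ) : ℂ) • v) v k j := by
  rcases eq_or_ne k j with rfl | hkj
  · simp [rayForm]
  set a : C(I, ℂ) := ContinuousMap.const I (Z₀ k - Z₀ j)
    + (v k - v j) • (⟨fun t => ((t : ℝ) : ℂ), by fun_prop⟩ : C(I, ℂ)) with ha
  have hat (t : I) : a t = (Z₀ + ((t : ℝ) : ℂ) • v) k - (Z₀ + ((t : ℝ) : ℂ) • v) j := by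
    simp [ha]
    ring
  have h0 (t : I) : a t ≠ 0 := by
    rw [hat]
    exact sub_ne_zero.2 (hreg t t.2 _ _ hkj)
  have hinv : a t * Ring.inverse a t = 1 :=
    DFunLike.congr_fun (Ring.mul_inverse_cancel a ((ContinuousMap.isUnit_iff_forall_ne_zero a).2 h0)) t
  rw [dlogDiff, ← hat, div_eq_mul_inv, ← eq_inv_of_mul_eq_one_right hinv]
  rfl

/-- The integral form of the isomonodromy equations along the ray `t ↦ Z₀ + t • q.1`, for the
unknown `q.2`. -/
noncomputable def rayDefect (Z₀ : Fin n → ℂ) (f₀ : Fin n → Fin n → ℂ)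
    (q : (Fin n → ℂ) × (Fin n → Fin n → C(I, ℂ))) (i j : Fin n) : C(I, ℂ) :=
  q.2 i j - ContinuousMap.const I (f₀ i j) -
    primitive (∑ k, q.2 i k * q.2 k j * (rayForm Z₀ q.1 k j - rayForm Z₀ q.1 i k))

lemma contDiffAt_rayDefect {Z₀ : Fin n → ℂ} (hZ₀ : ∀ i j, i ≠ j → Z₀ i ≠ Z₀ j)
    (f₀ : Fin n → Fin n → ℂ) (y : Fin n → Fin n → C(I, ℂ)) :
    ContDiffAt ℂ 2 (rayDefect Z₀ f₀) (0, y) := by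
  have hform (k j : Fin n) : ContDiffAt ℂ 2
      (fun q : (Fin n → ℂ) × (Fin n → Fin n → C(I, ℂ)) => rayForm Z₀ q.1 k j) (0, y) :=
    (contDiffAt_rayForm hZ₀ k j).comp (0, y) contDiffAt_fst
  have hval (i j : Fin n) : ContDiffAt ℂ 2
      (fun q : (Fin n → ℂ) × (Fin n → Fin n → C(I, ℂ)) => q.2 i j) (0, y) := by
    fun_prop
  refine contDiffAt_pi.2 fun i => contDiffAt_pi.2 fun j => ?_
  exact ((hval i j).sub contDiffAt_const).sub (primitive.contDiff.contDiffAt.comp _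
    (ContDiffAt.sum fun k _ => ((hval i k).mul (hval k j)).mul ((hform k j).sub (hform i k))))

lemma fderiv_rayDefect_inr {Z₀ : Fin n → ℂ} (hZ₀ : ∀ i j, i ≠ j → Z₀ i ≠ Z₀ j)
    (f₀ : Fin n → Fin n → ℂ) (y : Fin n → Fin n → C(I, ℂ)) :
    fderiv ℂ (rayDefect Z₀ f₀) (0, y) ∘L .inr ℂ (Fin n → ℂ) (Fin n → Fin n → C(I, ℂ)) =
      .id ℂ _ := by
  have h₁ := (((contDiffAt_rayDefect hZ₀ f₀ y).differentiableAt
    (by norm_num)).hasFDerivAt).comp y (hasFDerivAt_prodMk_right (𝕜 := ℂ) (0 : Fin n → ℂ) y)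
  have h₂ : HasFDerivAt (fun g : Fin n → Fin n → C(I, ℂ) => rayDefect Z₀ f₀ (0, g))
      (.id ℂ _) y := by
    have : (fun g : Fin n → Fin n → C(I, ℂ) => rayDefect Z₀ f₀ (0, g)) =
        fun g => g - fun i j => ContinuousMap.const I (f₀ i j) := by
      ext g i j t
      simp [rayDefect]
    rw [this]
    exact (hasFDerivAt_id y).sub_const _
  exact h₁.unique h₂

/-- The integral equation along rays has a family of solutions depending holomorphically on the
ray, and it is locally unique. -/
lemma exists_rayDefect_eq_zero {Z₀ : Fin n → ℂ} (hZ₀ : ∀ i j, i ≠ j → Z₀ i ≠ Z₀ j)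
    (f₀ : Fin n → Fin n → ℂ) :
    ∃ ψ : (Fin n → ℂ) → Fin n → Fin n → C(I, ℂ), ContDiffAt ℂ 2 ψ 0 ∧
      (ψ 0 = fun i j => ContinuousMap.const I (f₀ i j)) ∧
      (∀ᶠ v in 𝓝 0, rayDefect Z₀ f₀ (v, ψ v) = 0) ∧
      ∀ᶠ q in 𝓝 ((0 : Fin n → ℂ), fun i j => ContinuousMap.const I (f₀ i j)),
        rayDefect Z₀ f₀ q = 0 → ψ q.1 = q.2 := by
  set y : Fin n → Fin n → C(I, ℂ) := fun i j => ContinuousMap.const I (f₀ i j) with hy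
  have h := contDiffAt_rayDefect hZ₀ f₀ y
  have hinv : (fderiv ℂ (rayDefect Z₀ f₀) (0, y) ∘L
      .inr ℂ (Fin n → ℂ) (Fin n → Fin n → C(I, ℂ))).IsInvertible := by
    rw [fderiv_rayDefect_inr hZ₀]
    exact ⟨.refl ℂ _, rfl⟩
  have h0 : rayDefect Z₀ f₀ (0, y) = 0 := by
    ext i j t
    simp [rayDefect, hy]
  refine ⟨h.implicitFunction two_ne_zero hinv, h.contDiffAt_implicitFunction two_ne_zero hinv,
    h.implicitFunction_apply_self two_ne_zero hinv, ?_, ?_⟩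
  · simpa only [h0] using h.eventually_apply_implicitFunction two_ne_zero hinv
  · filter_upwards [h.eventually_apply_eq_iff_implicitFunction two_ne_zero hinv] with q hq hq0
    exact hq.1 (hq0.trans h0.symm)

/-- `y` solves the isomonodromy equations along the ray `t ↦ Z₀ + t • v`, `0 ≤ t ≤ 1`, with initial
value `f₀`. -/
structure IsRaySolution (Z₀ : Fin n → ℂ) (f₀ : Fin n → Fin n → ℂ) (v : Fin n → ℂ)
    (y : ℝ → Fin n → Fin n → ℂ) : Prop where
  zero : y 0 = f₀
  hasDerivAt : ∀ t ∈ Set.Icc (0 : ℝ) 1, ∀ i j,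
    HasDerivAt (fun s => y s i j) (isoField (Z₀ + (t : ℂ) • v) (y t) v i j) t

lemma IsRaySolution.rescale {Z₀ : Fin n → ℂ} {f₀ : Fin n → Fin n → ℂ} {v : Fin n → ℂ}
    {y : ℝ → Fin n → Fin n → ℂ} (hy : IsRaySolution Z₀ f₀ v y) {c : ℝ}
    (hc : c ∈ Set.Icc (0 : ℝ) 1) : IsRaySolution Z₀ f₀ ((c : ℂ) • v) fun t => y (c * t) where
  zero := by simpa using hy.zero
  hasDerivAt t ht i j := by
    have h := (hy.hasDerivAt (c * t) ⟨mul_nonneg hc.1 ht.1, mul_le_one₀ hc.2 ht.1 ht.2⟩ i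
      j).scomp t ((hasDerivAt_id t).const_mul c)
    refine h.congr_deriv ?_
    rw [isoField_smul, smul_smul, mul_one, Complex.real_smul, Complex.ofReal_mul,
      mul_comm (t : ℂ)]

lemma exists_isRaySolution {Z₀ v : Fin n → ℂ} {f₀ : Fin n → Fin n → ℂ}
    (hreg : ∀ t ∈ Set.Icc (0 : ℝ) 1, ∀ i j, i ≠ j →
      (Z₀ + (t : ℂ) • v) i ≠ (Z₀ + (t : ℂ) • v) j) {g : Fin n → Fin n → C(I, ℂ)}
    (hg : rayDefect Z₀ f₀ (v, g) = 0) :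
    ∃ y, IsRaySolution Z₀ f₀ v y ∧ ∀ (t : I) i j, y t i j = g i j t := by
  let a (i j : Fin n) : C(I, ℂ) := ∑ k, g i k * g k j * (rayForm Z₀ v k j - rayForm Z₀ v i k)
  let y (t : ℝ) (i j : Fin n) : ℂ :=
    f₀ i j + ∫ s in (0 : ℝ)..t, Set.IccExtend zero_le_one (a i j) s
  have hyg (t : I) (i j : Fin n) : y t i j = g i j t := by
    have := DFunLike.congr_fun (congrFun (congrFun hg i) j) t
    simp only [rayDefect, ContinuousMap.sub_apply, ContinuousMap.const_apply, primitive_apply,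
      Pi.zero_apply, ContinuousMap.zero_apply] at this
    linear_combination -this
  refine ⟨y, ⟨by ext; simp [y], fun t ht i j => ?_⟩, hyg⟩
  have hc : Continuous (Set.IccExtend zero_le_one (a i j)) :=
    (a i j).continuous.Icc_extend'
  refine ((hc.integral_hasStrictDerivAt 0 t).hasDerivAt.const_add (f₀ i j)).congr_deriv ?_
  rw [Set.IccExtend_of_mem _ _ ht]
  simp only [a, ContinuousMap.sum_apply, ContinuousMap.mul_apply, ContinuousMap.sub_apply,
    rayForm_apply hreg, isoField, ← hyg]

lemma IsRaySolution.rayDefect_eq_zero {Z₀ v : Fin n → ℂ} {f₀ : Fin n → Fin n → ℂ}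
    (hreg : ∀ t ∈ Set.Icc (0 : ℝ) 1, ∀ i j, i ≠ j →
      (Z₀ + (t : ℂ) • v) i ≠ (Z₀ + (t : ℂ) • v) j) {y : ℝ → Fin n → Fin n → ℂ}
    (hy : IsRaySolution Z₀ f₀ v y) {g : Fin n → Fin n → C(I, ℂ)}
    (hyg : ∀ (t : I) i j, y t i j = g i j t) : rayDefect Z₀ f₀ (v, g) = 0 := by
  ext i j t
  set a : C(I, ℂ) := ∑ k, g i k * g k j * (rayForm Z₀ v k j - rayForm Z₀ v i k) with ha
  have hc : Continuous (Set.IccExtend zero_le_one a) := a.continuous.Icc_extend'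
  have h := intervalIntegral.integral_eq_sub_of_hasDerivAt (a := 0) (b := (t : ℝ))
    (f := fun s => y s i j) (f' := Set.IccExtend zero_le_one a) (fun s hs => ?_)
    (hc.intervalIntegrable _ _)
  · simp only [rayDefect, ContinuousMap.sub_apply, ContinuousMap.const_apply, primitive_apply,
      Pi.zero_apply, ContinuousMap.zero_apply]
    rw [← ha, h, hyg, hy.zero]
    ring
  · have hs' : s ∈ Set.Icc (0 : ℝ) 1 := by
      rw [Set.uIcc_of_le t.2.1] at hs
      exact ⟨hs.1, hs.2.trans t.2.2⟩
    refine (hy.hasDerivAt s hs' i j).congr_deriv ?_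
    rw [Set.IccExtend_of_mem _ _ hs']
    simp only [ha, ContinuousMap.sum_apply, ContinuousMap.mul_apply, ContinuousMap.sub_apply,
      rayForm_apply hreg, isoField, ← hyg]

end Rays

section Local

variable {n : ℕ}

lemma eventually_injective {Z₀ : Fin n → ℂ} (hZ₀ : ∀ i j, i ≠ j → Z₀ i ≠ Z₀ j) :
    ∀ᶠ z in 𝓝 Z₀, ∀ i j, i ≠ j → z i ≠ z j := by
  simp only [Filter.eventually_all]
  exact fun i j hij =>
    (isOpen_ne_fun (continuous_apply i) (continuous_apply j)).mem_nhds (hZ₀ i j hij)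

/-- There is a twice differentiable function whose value at `Z₀ + v` is the value at time `1` of
the unique solution along the ray `t ↦ Z₀ + t • v` staying close to `f₀`. -/
lemma exists_endpoint_map {Z₀ : Fin n → ℂ} (hZ₀ : ∀ i j, i ≠ j → Z₀ i ≠ Z₀ j)
    (f₀ : Fin n → Fin n → ℂ) :
    ∃ r > 0, ∃ ε > 0, ∃ F : (Fin n → ℂ) → Fin n → Fin n → ℂ,
      (∀ z ∈ Metric.ball Z₀ r, ∀ i j, i ≠ j → z i ≠ z j) ∧
      (∀ z ∈ Metric.ball Z₀ r, ∀ i j, ContDiffAt ℂ 2 (fun x => F x i j) z) ∧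
      F Z₀ = f₀ ∧
      (∀ v ∈ Metric.ball 0 r, ∃ y, IsRaySolution Z₀ f₀ v y ∧
        ∀ t ∈ Set.Icc (0 : ℝ) 1, dist (y t) f₀ < ε) ∧
      ∀ v ∈ Metric.ball 0 r, ∀ y, IsRaySolution Z₀ f₀ v y →
        (∀ t ∈ Set.Icc (0 : ℝ) 1, dist (y t) f₀ < ε) → y 1 = F (Z₀ + v) := by
  obtain ⟨ψ, hψ, hψ₀, hzero, huniq⟩ := exists_rayDefect_eq_zero hZ₀ f₀
  obtain ⟨δ, hδ, huniq⟩ := Metric.eventually_nhds_iff.1 huniq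
  have hclose : ∀ᶠ v in 𝓝 0, dist (ψ v) (ψ 0) < δ / 2 :=
    hψ.continuousAt.eventually (Metric.ball_mem_nhds _ (half_pos hδ))
  have hdiff := hψ.eventually (by simp)
  have hreg : ∀ᶠ v in 𝓝 0, ∀ i j, i ≠ j → (Z₀ + v) i ≠ (Z₀ + v) j := by
    have : Tendsto (fun v => Z₀ + v) (𝓝 0) (𝓝 Z₀) :=
      (continuous_const.add continuous_id).tendsto' _ _ (add_zero _)
    exact this.eventually (eventually_injective hZ₀)
  obtain ⟨r, hr, hball⟩ := Metric.eventually_nhds_iff_ball.1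
    (hzero.and (hclose.and (hdiff.and hreg)))
  have hreg' (z) (hz : z ∈ Metric.ball Z₀ r) : ∀ i j, i ≠ j → z i ≠ z j := by
    simpa using (hball (z - Z₀) (by simpa [dist_eq_norm] using hz)).2.2.2
  refine ⟨min r δ, lt_min hr hδ, δ / 2, half_pos hδ, fun z i j => ψ (z - Z₀) i j 1,
    fun z hz => hreg' z (Metric.ball_subset_ball (min_le_left _ _) hz), fun z hz i j => ?_, ?_,
    fun v hv => ?_, fun v hv y hy hyε => ?_⟩
  · have hz' : z - Z₀ ∈ Metric.ball 0 r := by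
      simpa [dist_eq_norm] using Metric.ball_subset_ball (min_le_left _ _) hz
    have h₁ := contDiffAt_pi.1 (contDiffAt_pi.1 (hball _ hz').2.2.1 i) j
    have h₂ : ContDiffAt ℂ 2 (fun x => ψ (x - Z₀) i j) z :=
      h₁.comp z (contDiffAt_id.sub contDiffAt_const)
    exact (ContinuousMap.evalCLM ℂ (1 : unitInterval)).contDiff.contDiffAt.comp z h₂
  · simp [hψ₀]
  · have hv' := Metric.ball_subset_ball (min_le_left _ _) hv
    obtain ⟨y, hy, hyψ⟩ := exists_isRaySolution
      (fun t ht => hreg' _ (add_smul_mem_ball hv' ht)) (hball v hv').1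
    refine ⟨y, hy, fun t ht => ?_⟩
    refine (dist_pi_lt_iff (half_pos hδ)).2 fun i => (dist_pi_lt_iff (half_pos hδ)).2 fun j => ?_
    refine lt_of_le_of_lt ?_ (hball v hv').2.1
    have := (ContinuousMap.dist_apply_le_dist (f := ψ v i j) (g := ψ 0 i j) ⟨t, ht⟩).trans
      ((dist_le_pi_dist (ψ v i) (ψ 0 i) j).trans (dist_le_pi_dist (ψ v) (ψ 0) i))
    rw [← hyψ] at this
    simpa only [hψ₀, ContinuousMap.const_apply] using this
  · have hv' := Metric.ball_subset_ball (min_le_left _ _) hv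
    let g (i j : Fin n) : C(unitInterval, ℂ) :=
      ⟨fun t => y t i j, continuousOn_iff_continuous_domRestrict.1
        fun t ht => (hy.hasDerivAt t ht i j).continuousAt.continuousWithinAt⟩
    have hg := hy.rayDefect_eq_zero (fun t ht => hreg' _ (add_smul_mem_ball hv' ht)) (g := g)
      fun _ _ _ => rfl
    have hq : dist (v, g) ((0 : Fin n → ℂ), fun i j => .const unitInterval (f₀ i j)) < δ := by
      refine max_lt (Metric.ball_subset_ball (min_le_right _ _) hv)
        (lt_of_le_of_lt ?_ (half_lt_self hδ))
      refine (dist_pi_le_iff (half_pos hδ).le).2 fun i =>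
        (dist_pi_le_iff (half_pos hδ).le).2 fun j =>
          (ContinuousMap.dist_le (half_pos hδ).le).2 fun t => ?_
      exact ((dist_le_pi_dist (y t i) (f₀ i) j).trans (dist_le_pi_dist (y t) f₀ i)).trans
        (hyε t t.2).le
    have := huniq hq hg
    ext i j
    simp only [add_sub_cancel_left, this]
    rfl

/-- The initial value problem for the isomonodromy equations in all directions is solvable, and the
solution is determined along rays. -/
lemma exists_isoField_solution {Z₀ : Fin n → ℂ} (hZ₀ : ∀ i j, i ≠ j → Z₀ i ≠ Z₀ j)
    (f₀ : Fin n → Fin n → ℂ) :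
    ∃ r > 0, ∃ ε > 0, ∃ F : (Fin n → ℂ) → Fin n → Fin n → ℂ,
      (∀ z ∈ Metric.ball Z₀ r, ∀ i j, i ≠ j → z i ≠ z j) ∧
      (∀ z ∈ Metric.ball Z₀ r, ∀ i j, DifferentiableAt ℂ (fun x => F x i j) z) ∧
      F Z₀ = f₀ ∧
      (∀ z ∈ Metric.ball Z₀ r, ∀ w i j,
        fderiv ℂ (fun x => F x i j) z w = isoField z (F z) w i j) ∧
      ∀ v ∈ Metric.ball 0 r, ∀ y, IsRaySolution Z₀ f₀ v y →
        (∀ t ∈ Set.Icc (0 : ℝ) 1, dist (y t) f₀ < ε) → y 1 = F (Z₀ + v) := by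
  obtain ⟨r, hr, ε, hε, F, hreg, hF, hF₀, hex, huniq⟩ := exists_endpoint_map hZ₀ f₀
  refine ⟨r, hr, ε, hε, F, hreg, fun z hz i j => (hF z hz i j).differentiableAt (by norm_num), hF₀,
    fun z hz => fderiv_eq_isoField_of_radial hreg hF (fun z hz i j => ?_) hz, huniq⟩
  obtain ⟨v, rfl⟩ : ∃ v, z = Z₀ + v := ⟨z - Z₀, by simp⟩
  rw [add_sub_cancel_left]
  have hv : v ∈ Metric.ball 0 r := by simpa [mem_ball_iff_norm] using hz
  obtain ⟨y, hy, hyε⟩ := hex v hv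
  have hyF (c : ℝ) (hc : c ∈ Set.Icc (0 : ℝ) 1) : y c = F (Z₀ + (c : ℂ) • v) := by
    have hcv : (c : ℂ) • v ∈ Metric.ball 0 r := by
      simpa using add_smul_mem_ball (Z₀ := 0) hv hc
    simpa using huniq _ hcv _ (hy.rescale hc) fun t ht =>
      hyε _ ⟨mul_nonneg hc.1 ht.1, mul_le_one₀ hc.2 ht.1 ht.2⟩
  have h1 : (1 : ℝ) ∈ Set.Icc (0 : ℝ) 1 := by simp
  have hl : HasDerivAt (fun s : ℂ => Z₀ + s • v) v ((1 : ℝ) : ℂ) := by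
    simpa using ((hasDerivAt_id ((1 : ℝ) : ℂ)).smul_const v).const_add Z₀
  have hd : HasFDerivAt (fun x => F x i j) (fderiv ℂ (fun x => F x i j) (Z₀ + v))
      (Z₀ + ((1 : ℝ) : ℂ) • v) := by
    simpa using ((hF _ hz i j).differentiableAt (by norm_num)).hasFDerivAt
  have h₁ := (hd.comp_hasDerivAt _ hl).comp_ofReal.hasDerivWithinAt (s := Set.Icc 0 1)
  have h₂ := (hy.hasDerivAt 1 h1 i j).hasDerivWithinAt (s := Set.Icc 0 1)
  have h₃ := h₂.congr (f₁ := fun s : ℝ => F (Z₀ + (s : ℂ) • v) i j)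
    (fun s hs => by rw [hyF s hs]) (by rw [hyF 1 h1])
  have := (uniqueDiffOn_Icc zero_lt_one 1 h1).eq_deriv _ h₁ h₃
  simpa [hyF 1 h1] using this

end Local

section Equations

variable {n : ℕ}

/-- For matrices with zero diagonal, `isoField` along coordinate vectors is the right-hand side of
the isomonodromy equations. -/
lemma isoField_single {z : Fin n → ℂ} {y : Fin n → Fin n → ℂ} (hy : ∀ i, y i i = 0)
    (m i j : Fin n) :
    isoField z y (Pi.single m 1) i j =
      ∑ k ∈ (Finset.univ \ {i, j} : Finset (Fin n)), y i k * y k j *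
        (((if k = m then (1 : ℂ) else 0) - (if j = m then 1 else 0)) / (z k - z j) -
          ((if i = m then (1 : ℂ) else 0) - (if k = m then 1 else 0)) / (z i - z k)) := by
  rw [isoField, ← Finset.sum_subset (Finset.subset_univ (Finset.univ \ {i, j}))]
  · simp only [dlogDiff, Pi.single_apply]
  · intro k _ hk
    rcases (by simpa [or_iff_not_imp_left] using hk : k = i ∨ k = j) with rfl | rfl <;> simp [hy]

lemma isoField_add (z : Fin n → ℂ) (y : Fin n → Fin n → ℂ) (v w : Fin n → ℂ) (i j : Fin n) :
    isoField z y (v + w) i j = isoField z y v i j + isoField z y w i j := by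
  simp only [isoField, dlogDiff, Pi.add_apply, ← Finset.sum_add_distrib]
  exact Finset.sum_congr rfl fun k _ => by ring

lemma SolvesIsomonodromy.fderiv_eq_isoField {U : Set (Fin n → ℂ)}
    {f : (Fin n → ℂ) → Matrix (Fin n) (Fin n) ℂ} (hU : IsOpen U) (hf : SolvesIsomonodromy U f)
    {z : Fin n → ℂ} (hz : z ∈ U) (v : Fin n → ℂ) (i j : Fin n) :
    fderiv ℂ (fun x => f x i j) z v = isoField z (f z) v i j := by
  rcases eq_or_ne i j with rfl | hij
  · have : (fun x => f x i i) =ᶠ[𝓝 z] fun _ => 0 :=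
      Filter.mem_of_superset (hU.mem_nhds hz) fun x hx => hf.1 x hx i
    rw [this.fderiv_eq, isoField_diag z (f z), fderiv_const_apply]
    rfl
  · let L : (Fin n → ℂ) →ₗ[ℂ] ℂ :=
      { toFun v := isoField z (f z) v i j
        map_add' v w := isoField_add _ _ _ _ _ _
        map_smul' c v := isoField_smul _ _ _ _ _ _ }
    have : (fderiv ℂ (fun x => f x i j) z : (Fin n → ℂ) →ₗ[ℂ] ℂ) = L :=
      (Pi.basisFun ℂ (Fin n)).ext fun m => by
        simpa [L] using (hf.2.2 z hz i j hij m).trans (isoField_single (hf.1 z hz) m i j).symm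
    exact LinearMap.congr_fun this v

lemma SolvesIsomonodromy.isRaySolution {U : Set (Fin n → ℂ)}
    {f : (Fin n → ℂ) → Matrix (Fin n) (Fin n) ℂ} (hU : IsOpen U) (hf : SolvesIsomonodromy U f)
    {Z₀ v : Fin n → ℂ} (hv : ∀ t ∈ Set.Icc (0 : ℝ) 1, Z₀ + (t : ℂ) • v ∈ U) :
    IsRaySolution Z₀ (f Z₀) v fun t => f (Z₀ + (t : ℂ) • v) where
  zero := by
    simp only [Complex.ofReal_zero, zero_smul, add_zero]
    rfl
  hasDerivAt t ht i j := by
    have hl : HasDerivAt (fun s : ℂ => Z₀ + s • v) v (t : ℂ) := by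
      simpa using ((hasDerivAt_id (t : ℂ)).smul_const v).const_add Z₀
    rw [← hf.fderiv_eq_isoField hU (hv t ht)]
    exact ((hf.2.1 _ (hv t ht) i j).hasFDerivAt.comp_hasDerivAt (t : ℂ) hl).comp_ofReal

/-- A solution of the isomonodromy equations is determined near `Z₀` by its solutions along rays. -/
lemma SolvesIsomonodromy.eventuallyEq {U : Set (Fin n → ℂ)}
    {f : (Fin n → ℂ) → Matrix (Fin n) (Fin n) ℂ} (hU : IsOpen U) (hf : SolvesIsomonodromy U f)
    {Z₀ : Fin n → ℂ} (hZ₀ : Z₀ ∈ U) {r ε : ℝ} (hr : 0 < r) (hε : 0 < ε)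
    {F : (Fin n → ℂ) → Fin n → Fin n → ℂ}
    (hF : ∀ v ∈ Metric.ball 0 r, ∀ y, IsRaySolution Z₀ (f Z₀) v y →
      (∀ t ∈ Set.Icc (0 : ℝ) 1, dist (y t) (fun i j => f Z₀ i j) < ε) → y 1 = F (Z₀ + v)) :
    f =ᶠ[𝓝 Z₀] F := by
  have hcont : ContinuousAt (fun z i j => f z i j) Z₀ :=
    continuousAt_pi.2 fun i => continuousAt_pi.2 fun j => (hf.2.1 Z₀ hZ₀ i j).continuousAt
  obtain ⟨s, hs, hball⟩ := Metric.eventually_nhds_iff_ball.1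
    ((hU.eventually_mem hZ₀).and (hcont.eventually (Metric.ball_mem_nhds _ hε)))
  filter_upwards [Metric.ball_mem_nhds Z₀ (lt_min hs hr)] with z hz
  obtain ⟨v, rfl⟩ : ∃ v, z = Z₀ + v := ⟨z - Z₀, by simp⟩
  have hv : v ∈ Metric.ball 0 (min s r) := by simpa [mem_ball_iff_norm] using hz
  have hmem (t : ℝ) (ht : t ∈ Set.Icc (0 : ℝ) 1) :=
    hball _ (add_smul_mem_ball (Z₀ := Z₀) (Metric.ball_subset_ball (min_le_left _ _) hv) ht)
  have := hF v (Metric.ball_subset_ball (min_le_right _ _) hv) _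
    (hf.isRaySolution hU fun t ht => (hmem t ht).1) fun t ht => (hmem t ht).2
  simp only [Complex.ofReal_one, one_smul] at this
  exact this

lemma solvesIsomonodromy_of_fderiv_eq_isoField {Z₀ : Fin n → ℂ} {r : ℝ}
    {F : (Fin n → ℂ) → Matrix (Fin n) (Fin n) ℂ} (hF₀ : ∀ i, F Z₀ i i = 0)
    (hdiff : ∀ z ∈ Metric.ball Z₀ r, ∀ i j, DifferentiableAt ℂ (fun x => F x i j) z)
    (hF : ∀ z ∈ Metric.ball Z₀ r, ∀ w i j,
      fderiv ℂ (fun x => F x i j) z w = isoField z (F z) w i j) :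
    SolvesIsomonodromy (Metric.ball Z₀ r) F := by
  have hdiag (z) (hz : z ∈ Metric.ball Z₀ r) (i : Fin n) : F z i i = 0 := by
    have := Metric.isOpen_ball.is_const_of_fderiv_eq_zero (𝕜 := ℂ) (f := fun x => F x i i)
      (convex_ball Z₀ r).isPreconnected
      (fun z hz => (hdiff z hz i i).differentiableWithinAt)
      (fun z hz => by ext w; exact (hF z hz w i i).trans (isoField_diag z (F z) w i))
      hz (Metric.mem_ball_self (Metric.pos_of_mem_ball hz))
    exact this.trans (hF₀ i)
  exact ⟨hdiag, hdiff, fun z hz i j _ m => by rw [hF z hz, isoField_single (hdiag z hz)]⟩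

end Equations

/-- **Local solvability and uniqueness for the isomonodromy equations** (case
`G = GLₙ(ℂ)`): for `Z₀ ∈ ℂⁿ` with pairwise distinct coordinates and `f⁰` with
zero diagonal, there is a holomorphic solution `f` of the isomonodromy equations
with `f(Z₀) = f⁰` on an open connected neighbourhood `U` of `Z₀` contained in the
set of regular points; moreover any two such solutions agree near `Z₀`. -/
theorem isomonodromy_local_existsUnique {n : ℕ} (hn : 1 ≤ n) (Z₀ : Fin n → ℂ)
    (hZ₀ : ∀ i j : Fin n, i ≠ j → Z₀ i ≠ Z₀ j)
    (f₀ : Matrix (Fin n) (Fin n) ℂ) (hf₀ : ∀ i, f₀ i i = 0) :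
    (∃ (U : Set (Fin n → ℂ)) (f : (Fin n → ℂ) → Matrix (Fin n) (Fin n) ℂ),
      IsOpen U ∧ IsConnected U ∧ Z₀ ∈ U ∧
      U ⊆ {w : Fin n → ℂ | ∀ i j : Fin n, i ≠ j → w i ≠ w j} ∧
      SolvesIsomonodromy U f ∧ f Z₀ = f₀) ∧
    (∀ (U₁ U₂ : Set (Fin n → ℂ))
      (f₁ f₂ : (Fin n → ℂ) → Matrix (Fin n) (Fin n) ℂ),
      IsOpen U₁ → Z₀ ∈ U₁ → SolvesIsomonodromy U₁ f₁ → f₁ Z₀ = f₀ →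
      IsOpen U₂ → Z₀ ∈ U₂ → SolvesIsomonodromy U₂ f₂ → f₂ Z₀ = f₀ →
      ∃ V ∈ 𝓝 Z₀, Set.EqOn f₁ f₂ V) := by
  obtain ⟨r, hr, ε, hε, F, hreg, hdiff, hF₀, hF, huniq⟩ := exists_isoField_solution hZ₀ f₀
  refine ⟨⟨Metric.ball Z₀ r, F, Metric.isOpen_ball, ⟨⟨Z₀, Metric.mem_ball_self hr⟩,
    (convex_ball Z₀ r).isPreconnected⟩, Metric.mem_ball_self hr, hreg,
    solvesIsomonodromy_of_fderiv_eq_isoField (fun i => by rw [hF₀, hf₀]) hdiff hF, hF₀⟩, ?_⟩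
  intro U₁ U₂ f₁ f₂ hU₁ hZ₁ hf₁ h₁ hU₂ hZ₂ hf₂ h₂
  have e₁ : f₁ =ᶠ[𝓝 Z₀] F := hf₁.eventuallyEq hU₁ hZ₁ hr hε (by rw [h₁]; exact huniq)
  have e₂ : f₂ =ᶠ[𝓝 Z₀] F := hf₂.eventuallyEq hU₂ hZ₂ hr hε (by rw [h₂]; exact huniq)
  exact (e₁.trans e₂.symm).exists_mem
end
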